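/- arXiv:1310.0807 — 2 statements merged into one kernel-verified Lean document; each statement's English description precedes it below -/
import Mathlib

section
/- There exist positive universal constants c0 and C2 such that the following holds. Fix integers n ≥ 2, r ≥ 1 and m > c0·r·log^{10}(n), draw sensing vectors a_1, …, a_m from the sub-Gaussian sampling model with fourth moment μ4 ≤ 3, and let A be the associated quadratic sampling operator. Then with probability at least 1 − 1/n² the following event holds: for every positive semidefinite symmetric Toeplitz matrix Σ ∈ ℝ^{n×n} of rank at most r, every ε2 ≥ 0, every noise vector η ∈ ℝ^m with ‖η‖_2 ≤ ε2, and y := A(Σ) + η, any matrix Σ̂ that minimizes trace(M) over all positive semidefinite Toeplitz matrices M ∈ ℝ^{n×n} satisfying ‖y − A(M)‖_2 ≤ ε2 obeys ‖Σ̂ − Σ‖_F ≤ C2·ε2/√m. -/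
open MeasureTheory ProbabilityTheory Matrix

noncomputable section

/-- Frobenius norm of a real square matrix. -/
def frobNorm {n : ℕ} (X : Matrix (Fin n) (Fin n) ℝ) : ℝ :=
  Real.sqrt (∑ i, ∑ j, X i j ^ 2)

/-- ℓ¹ norm of a vector. -/
def vecL1 {m : ℕ} (v : Fin m → ℝ) : ℝ := ∑ i, |v i|

/-- ℓ² norm of a vector. -/
def vecL2 {m : ℕ} (v : Fin m → ℝ) : ℝ := Real.sqrt (∑ i, v i ^ 2)

/-- A probability distribution on ℝ is sub-Gaussian if its sub-Gaussian norm
`sup_{p ≥ 1} p^{-1/2} (E|x|^p)^{1/p}` is finite. -/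
def IsSubGaussianMeasure (μ : Measure ℝ) : Prop :=
  ∃ K : ℝ, 0 < K ∧ ∀ p : ℝ, 1 ≤ p → (∫ x, |x| ^ p ∂μ) ≤ (K * Real.sqrt p) ^ p

/-- Distribution of the entries in the sub-Gaussian sampling model:
mean `0`, variance `1`, fourth moment `μ₄ > 1`, sub-Gaussian. -/
def SubGaussianSamplingDist (μ : Measure ℝ) : Prop :=
  IsProbabilityMeasure μ ∧ IsSubGaussianMeasure μ ∧
    (∫ x, x ∂μ) = 0 ∧ (∫ x, x ^ 2 ∂μ) = 1 ∧ 1 < ∫ x, x ^ 4 ∂μ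

/-- The sensing vectors `a i : Ω → (Fin n → ℝ)` have all their entries (jointly across
`i` and the coordinates) i.i.d. with common distribution `μ`. -/
def SamplingModel {Ω : Type} [MeasurableSpace Ω] (P : Measure Ω) {m n : ℕ}
    (a : Fin m → Ω → Fin n → ℝ) (μ : Measure ℝ) : Prop :=
  (∀ i j, Measurable fun ω => a i ω j) ∧
    iIndepFun (m := fun _ : Fin m × Fin n => (inferInstance : MeasurableSpace ℝ))
      (fun p ω => a p.1 ω p.2) P ∧
    ∀ i j, Measure.map (fun ω => a i ω j) P = μ

/-- The quadratic sampling operator `X ↦ (aᵢᵀ X aᵢ)ᵢ`. -/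
def quadMeas {n m : ℕ} (av : Fin m → Fin n → ℝ) (X : Matrix (Fin n) (Fin n) ℝ) :
    Fin m → ℝ := fun i => av i ⬝ᵥ X.mulVec (av i)

/-- A matrix is Toeplitz when it is constant along each descending diagonal. -/
def IsToeplitz {n : ℕ} (M : Matrix (Fin n) (Fin n) ℝ) : Prop :=
  ∀ i j k l : Fin n, i.1 + l.1 = k.1 + j.1 → M i j = M k l

/-- The second moment of `u` is `F` and its fourth moment is at most `(K * F) ^ 2`. -/
structure MomentBound {α : Type*} [MeasurableSpace α] (ρ : Measure α) (u : α → ℝ) (F K : ℝ) :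
    Prop where
  measurable : Measurable u
  integrable : Integrable (fun y => u y ^ 4) ρ
  second : ∫ y, u y ^ 2 ∂ρ = F
  fourth : ∫ y, u y ^ 4 ∂ρ ≤ (K * F) ^ 2

/-- A centred distribution on the line with unit variance and fourth moment at most three. -/
structure UnitMoments (μ : Measure ℝ) : Prop where
  prob : IsProbabilityMeasure μ
  mean : ∫ x, x ∂μ = 0
  second : ∫ x, x ^ 2 ∂μ = 1
  integrable : Integrable (fun x => x ^ 4) μ
  fourth : ∫ x, x ^ 4 ∂μ ≤ 3

lemma UnitMoments.integrable_sq {μ : Measure ℝ} (h : UnitMoments μ) :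
    Integrable (fun x : ℝ => x ^ 2) μ := by
  by_contra hc
  have := h.second
  rw [integral_undef hc] at this
  norm_num at this

lemma UnitMoments.integrable_id {μ : Measure ℝ} (h : UnitMoments μ) :
    Integrable (fun x : ℝ => x) μ := by
  have := h.prob
  refine Integrable.mono' (h.integrable_sq.add (integrable_const 1)) (by fun_prop) ?_
  refine Filter.Eventually.of_forall fun x => ?_
  simp only [Pi.add_apply, Real.norm_eq_abs]
  nlinarith [sq_nonneg (|x| - 1), sq_abs x, abs_nonneg x]

lemma integrable_mul_of_fourth {α : Type*} [MeasurableSpace α] {ρ : Measure α} {f g : α → ℝ}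
    (hf : Measurable f) (hg : Measurable g) (hf4 : Integrable (fun y => f y ^ 4) ρ)
    (hg4 : Integrable (fun y => g y ^ 4) ρ) :
    Integrable (fun y => f y ^ 2 * g y ^ 2) ρ ∧ Integrable (fun y => f y ^ 3 * g y) ρ := by
  constructor
  · refine Integrable.mono' (hf4.add hg4) (by fun_prop) (Filter.Eventually.of_forall fun y => ?_)
    simp only [Pi.add_apply, Real.norm_eq_abs]
    rw [abs_of_nonneg (by positivity)]
    nlinarith [sq_nonneg (f y ^ 2 - g y ^ 2), sq_nonneg (f y ^ 2), sq_nonneg (g y ^ 2)]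
  · refine Integrable.mono' (hf4.add hg4) (by fun_prop) (Filter.Eventually.of_forall fun y => ?_)
    simp only [Pi.add_apply, Real.norm_eq_abs]
    rw [abs_le]
    constructor <;>
    nlinarith [sq_nonneg (f y * (f y + g y)), sq_nonneg (f y * (f y - g y)), sq_nonneg (g y ^ 2 - f y ^ 2),
      sq_nonneg (f y ^ 2), sq_nonneg (g y ^ 2)]

lemma integrable_sq_of_fourth {α : Type*} [MeasurableSpace α] {ρ : Measure α}
    [IsFiniteMeasure ρ] {f : α → ℝ}
    (hf : Measurable f) (hf4 : Integrable (fun y => f y ^ 4) ρ) :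
    Integrable (fun y => f y ^ 2) ρ := by
  have := (integrable_mul_of_fourth (g := fun _ => 1) hf measurable_const hf4 (by simp)).1
  simpa using this

lemma integral_sq_mul_sq_le {α : Type*} [MeasurableSpace α] {ρ : Measure α} {f g : α → ℝ}
    {A B : ℝ} (hf : Measurable f) (hg : Measurable g) (hf4 : Integrable (fun y => f y ^ 4) ρ)
    (hg4 : Integrable (fun y => g y ^ 4) ρ) (hA : 0 ≤ A) (hB : 0 ≤ B)
    (hfA : ∫ y, f y ^ 4 ∂ρ ≤ A ^ 2) (hgB : ∫ y, g y ^ 4 ∂ρ ≤ B ^ 2) :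
    ∫ y, f y ^ 2 * g y ^ 2 ∂ρ ≤ A * B := by
  have hI := (integrable_mul_of_fourth hf hg hf4 hg4).1
  have key : ∀ s : ℝ, 0 < s → ∀ t : ℝ, 0 < t →
      2 * s * t * ∫ y, f y ^ 2 * g y ^ 2 ∂ρ ≤ s ^ 2 * A ^ 2 + t ^ 2 * B ^ 2 := by
    intro s hs t ht
    calc 2 * s * t * ∫ y, f y ^ 2 * g y ^ 2 ∂ρ
        = ∫ y, 2 * s * t * (f y ^ 2 * g y ^ 2) ∂ρ := by rw [integral_const_mul]
      _ ≤ ∫ y, (s ^ 2 * f y ^ 4 + t ^ 2 * g y ^ 4) ∂ρ := by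
          refine integral_mono (hI.const_mul _) ((hf4.const_mul _).add (hg4.const_mul _)) fun y => ?_
          simp only
          nlinarith [sq_nonneg (s * f y ^ 2 - t * g y ^ 2)]
      _ = s ^ 2 * ∫ y, f y ^ 4 ∂ρ + t ^ 2 * ∫ y, g y ^ 4 ∂ρ := by
          rw [integral_add (hf4.const_mul _) (hg4.const_mul _), integral_const_mul,
            integral_const_mul]
      _ ≤ _ := by gcongr
  refine le_of_forall_pos_le_add fun ε hε => ?_
  have hlim : ∀ e : ℝ, 0 < e → ∫ y, f y ^ 2 * g y ^ 2 ∂ρ ≤ (A + e) * (B + e) := by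
    intro e he
    have h1 := key (B + e) (by positivity) (A + e) (by positivity)
    have h2 : 2 * (B + e) * (A + e) * ∫ y, f y ^ 2 * g y ^ 2 ∂ρ ≤
        2 * (B + e) * (A + e) * ((A + e) * (B + e)) := by
      refine h1.trans ?_
      have : A ^ 2 ≤ (A + e) ^ 2 := by gcongr; linarith
      have : B ^ 2 ≤ (B + e) ^ 2 := by gcongr; linarith
      nlinarith [sq_nonneg (A + e), sq_nonneg (B + e)]
    exact le_of_mul_le_mul_left h2 (by positivity)
  have hs : 0 < A + B + 1 := by positivity
  have h3 := hlim (min 1 (ε / (A + B + 1))) (by positivity)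
  have h4 : min 1 (ε / (A + B + 1)) * (A + B + 1) ≤ ε := by
    calc _ ≤ ε / (A + B + 1) * (A + B + 1) := by gcongr; exact min_le_right _ _
      _ = ε := by field_simp
  have h5 : min 1 (ε / (A + B + 1)) ≤ 1 := min_le_left _ _
  have h6 : 0 ≤ min 1 (ε / (A + B + 1)) := by positivity
  nlinarith

lemma MomentBound.add_mul {α : Type*} [MeasurableSpace α] {ρ : Measure α}
    [IsProbabilityMeasure ρ] {μ : Measure ℝ} (hμ : UnitMoments μ) {f g : α → ℝ}
    {F G K K' : ℝ} (hK' : 0 ≤ K') (hK : 4 * K' ≤ K) (hf : MomentBound ρ f F K)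
    (hg : MomentBound ρ g G K') :
    MomentBound (μ.prod ρ) (fun z => f z.2 + z.1 * g z.2) (F + G) K := by
  have := hμ.prob
  have hfm := hf.measurable
  have hgm := hg.measurable
  have hF : 0 ≤ F := hf.second ▸ integral_nonneg fun _ => by positivity
  have hG : 0 ≤ G := hg.second ▸ integral_nonneg fun _ => by positivity
  have hf2 := integrable_sq_of_fourth hfm hf.integrable
  have hg2 := integrable_sq_of_fourth hgm hg.integrable
  obtain ⟨hfg, hf3g⟩ := integrable_mul_of_fourth hfm hgm hf.integrable hg.integrable
  have hfg1 : Integrable (fun y => f y * g y) ρ := by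
    refine Integrable.mono' (hf2.add hg2) (by fun_prop) (Filter.Eventually.of_forall fun y => ?_)
    simp only [Pi.add_apply, Real.norm_eq_abs]
    rw [abs_le]
    constructor <;> nlinarith [sq_nonneg (f y + g y), sq_nonneg (f y - g y)]
  have i1 : Integrable (fun z : ℝ × α => (1 : ℝ) * f z.2 ^ 2) (μ.prod ρ) :=
    (integrable_const (1 : ℝ)).mul_prod hf2
  have i2 : Integrable (fun z : ℝ × α => z.1 * (f z.2 * g z.2)) (μ.prod ρ) :=
    hμ.integrable_id.mul_prod hfg1
  have i3 : Integrable (fun z : ℝ × α => z.1 ^ 2 * g z.2 ^ 2) (μ.prod ρ) :=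
    hμ.integrable_sq.mul_prod hg2
  have j1 : Integrable (fun z : ℝ × α => (1 : ℝ) * f z.2 ^ 4) (μ.prod ρ) :=
    (integrable_const (1 : ℝ)).mul_prod hf.integrable
  have j2 : Integrable (fun z : ℝ × α => z.1 * (f z.2 ^ 3 * g z.2)) (μ.prod ρ) :=
    hμ.integrable_id.mul_prod hf3g
  have j3 : Integrable (fun z : ℝ × α => z.1 ^ 2 * (f z.2 ^ 2 * g z.2 ^ 2)) (μ.prod ρ) :=
    hμ.integrable_sq.mul_prod hfg
  have j4 : Integrable (fun z : ℝ × α => z.1 ^ 4 * g z.2 ^ 4) (μ.prod ρ) :=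
    hμ.integrable.mul_prod hg.integrable
  have i12 : Integrable (fun z : ℝ × α => (1 : ℝ) * f z.2 ^ 2 + 2 * (z.1 * (f z.2 * g z.2)))
      (μ.prod ρ) := i1.add (i2.const_mul 2)
  have j12 : Integrable (fun z : ℝ × α => (1 : ℝ) * f z.2 ^ 4 +
      4 * (z.1 * (f z.2 ^ 3 * g z.2))) (μ.prod ρ) := j1.add (j2.const_mul 4)
  have j123 : Integrable (fun z : ℝ × α => (1 : ℝ) * f z.2 ^ 4 +
      4 * (z.1 * (f z.2 ^ 3 * g z.2)) + 8 * (z.1 ^ 2 * (f z.2 ^ 2 * g z.2 ^ 2))) (μ.prod ρ) :=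
    j12.add (j3.const_mul 8)
  have jj : Integrable (fun z : ℝ × α => (1 : ℝ) * f z.2 ^ 4 + 4 * (z.1 * (f z.2 ^ 3 * g z.2)) +
      8 * (z.1 ^ 2 * (f z.2 ^ 2 * g z.2 ^ 2)) + 3 * (z.1 ^ 4 * g z.2 ^ 4)) (μ.prod ρ) :=
    j123.add (j4.const_mul 3)
  have pw : ∀ z : ℝ × α, (f z.2 + z.1 * g z.2) ^ 4 ≤
      (1 : ℝ) * f z.2 ^ 4 + 4 * (z.1 * (f z.2 ^ 3 * g z.2)) +
      8 * (z.1 ^ 2 * (f z.2 ^ 2 * g z.2 ^ 2)) + 3 * (z.1 ^ 4 * g z.2 ^ 4) := by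
    intro z
    nlinarith [sq_nonneg (f z.2 * (z.1 * g z.2) - (z.1 * g z.2) ^ 2)]
  have hF4 : Integrable (fun z : ℝ × α => (f z.2 + z.1 * g z.2) ^ 4) (μ.prod ρ) := by
    refine Integrable.mono' jj (by fun_prop) (Filter.Eventually.of_forall fun z => ?_)
    rw [Real.norm_eq_abs, abs_of_nonneg (by positivity)]
    exact pw z
  refine ⟨by fun_prop, hF4, ?_, ?_⟩
  · calc ∫ z : ℝ × α, (f z.2 + z.1 * g z.2) ^ 2 ∂(μ.prod ρ)
        = ∫ z : ℝ × α, ((1 : ℝ) * f z.2 ^ 2 + 2 * (z.1 * (f z.2 * g z.2)) +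
            z.1 ^ 2 * g z.2 ^ 2) ∂(μ.prod ρ) := by
          congr 1; ext z; ring
      _ = F + G := by
          have e1 := integral_prod_mul (μ := μ) (ν := ρ) (fun _ : ℝ => (1 : ℝ)) (fun y => f y ^ 2)
          have e2 := integral_prod_mul (μ := μ) (ν := ρ) (fun z : ℝ => z) (fun y => f y * g y)
          have e3 := integral_prod_mul (μ := μ) (ν := ρ) (fun z : ℝ => z ^ 2) (fun y => g y ^ 2)
          rw [integral_add i12 i3, integral_add i1 (i2.const_mul 2),
            e1, integral_const_mul, e2, e3, hμ.mean, hμ.second, hf.second, hg.second]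
          simp
  · have e1 := integral_prod_mul (μ := μ) (ν := ρ) (fun _ : ℝ => (1 : ℝ)) (fun y => f y ^ 4)
    have e2 := integral_prod_mul (μ := μ) (ν := ρ) (fun z : ℝ => z) (fun y => f y ^ 3 * g y)
    have e3 := integral_prod_mul (μ := μ) (ν := ρ) (fun z : ℝ => z ^ 2)
      (fun y => f y ^ 2 * g y ^ 2)
    have e4 := integral_prod_mul (μ := μ) (ν := ρ) (fun z : ℝ => z ^ 4) (fun y => g y ^ 4)
    have hcs := integral_sq_mul_sq_le hfm hgm hf.integrable hg.integrable
      (A := K * F) (B := K' * G) (by nlinarith [mul_nonneg hK' hF]) (by positivity)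
      hf.fourth hg.fourth
    calc _ ≤ _ := integral_mono hF4 jj pw
      _ = ∫ y, f y ^ 4 ∂ρ + 8 * ∫ y, f y ^ 2 * g y ^ 2 ∂ρ +
          3 * ((∫ x, x ^ 4 ∂μ) * ∫ y, g y ^ 4 ∂ρ) := by
          rw [integral_add j123 (j4.const_mul 3),
            integral_add j12 (j3.const_mul 8),
            integral_add j1 (j2.const_mul 4), e1, integral_const_mul, integral_const_mul,
            integral_const_mul, e2, e3, e4, hμ.mean, hμ.second]
          simp
      _ ≤ (K * F) ^ 2 + 8 * (K * F * (K' * G)) + 3 * (3 * (K' * G) ^ 2) := by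
          have hg0 : 0 ≤ ∫ y, g y ^ 4 ∂ρ := integral_nonneg fun _ => by positivity
          have h4 := hμ.fourth
          have : (∫ x, x ^ 4 ∂μ) * ∫ y, g y ^ 4 ∂ρ ≤ 3 * (K' * G) ^ 2 :=
            mul_le_mul h4 hg.fourth hg0 (by norm_num)
          linarith [hf.fourth]
      _ ≤ (K * (F + G)) ^ 2 := by
          have hK0 : 0 ≤ K := by linarith
          have h1 : 4 * K' * K * (F * G) ≤ K * K * (F * G) := by
            have := mul_nonneg hF hG
            gcongr
          have h2 : (4 * K') ^ 2 * G ^ 2 ≤ K ^ 2 * G ^ 2 := by gcongr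
          nlinarith [sq_nonneg (K' * G)]

lemma MomentBound.pi_succ {n : ℕ} {μ : Measure ℝ} [SigmaFinite μ] {u : ℝ × (Fin n → ℝ) → ℝ}
    {F K : ℝ} (h : MomentBound (μ.prod (Measure.pi fun _ => μ)) u F K) :
    MomentBound (Measure.pi fun _ : Fin (n + 1) => μ) (fun x => u (x 0, fun i => x i.succ)) F K := by
  have hp := measurePreserving_piFinSuccAbove (fun _ : Fin (n + 1) => μ) 0
  have he : ∀ x : Fin (n + 1) → ℝ, MeasurableEquiv.piFinSuccAbove (fun _ => ℝ) 0 x =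
      (x 0, fun i => x i.succ) := fun x => rfl
  have hm := h.measurable
  refine ⟨by fun_prop, ?_, ?_, ?_⟩
  · have := (hp.integrable_comp_emb (MeasurableEquiv.measurableEmbedding _)).2 h.integrable
    exact this
  · rw [← h.second, ← hp.integral_comp' (fun z => u z ^ 2)]
    rfl
  · refine le_trans (le_of_eq ?_) h.fourth
    rw [← hp.integral_comp' (fun z => u z ^ 4)]
    rfl

lemma momentBound_linear {μ : Measure ℝ} (hμ : UnitMoments μ) (n : ℕ) (b : Fin n → ℝ) :
    MomentBound (Measure.pi fun _ : Fin n => μ) (fun x => ∑ i, b i * x i) (∑ i, b i ^ 2) 4 := by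
  have := hμ.prob
  induction n with
  | zero => exact ⟨by fun_prop, by simp, by simp, by simp⟩
  | succ n ih =>
    have hc : MomentBound (Measure.pi fun _ : Fin n => μ) (fun _ => b 0) (b 0 ^ 2) 1 :=
      ⟨measurable_const, integrable_const _, by simp, by simp; apply le_of_eq; ring⟩
    have h := ((ih fun i => b i.succ).add_mul hμ zero_le_one (by norm_num) hc).pi_succ
    convert h using 1
    · ext x; simp [Fin.sum_univ_succ]; ring
    · simp [Fin.sum_univ_succ]; ring

lemma momentBound_chaos {μ : Measure ℝ} (hμ : UnitMoments μ) (n : ℕ) (H : Fin n → Fin n → ℝ)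
    (hd : ∀ i, H i i = 0) (hs : ∀ i j, H i j = H j i) :
    MomentBound (Measure.pi fun _ : Fin n => μ) (fun x => ∑ i, ∑ j, H i j * x i * x j)
      (2 * ∑ i, ∑ j, H i j ^ 2) 16 := by
  have := hμ.prob
  induction n with
  | zero => exact ⟨by fun_prop, by simp, by simp, by simp⟩
  | succ n ih =>
    have h := ((ih (fun i j => H i.succ j.succ) (fun i => hd _) (fun i j => hs _ _)).add_mul hμ
      (by norm_num) (by norm_num)
      (momentBound_linear hμ n fun j => 2 * H 0 j.succ)).pi_succ
    convert h using 1
    · ext x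
      simp only [Fin.sum_univ_succ, hd, Finset.sum_add_distrib, Finset.mul_sum, hs _ 0]
      have : ∀ i : Fin n, x 0 * (2 * H 0 i.succ * x i.succ) =
        H 0 i.succ * x 0 * x i.succ + H 0 i.succ * x i.succ * x 0 := fun i => by ring
      simp only [this, Finset.sum_add_distrib]
      ring
    · simp only [Fin.sum_univ_succ, hd, Finset.sum_add_distrib, Finset.mul_sum, hs _ 0]
      have : ∀ i : Fin n, (2 * H 0 i.succ) ^ 2 = 2 * H 0 i.succ ^ 2 + 2 * H 0 i.succ ^ 2 :=
        fun i => by ring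
      simp only [this, Finset.sum_add_distrib, mul_add, Finset.mul_sum]
      ring

lemma integral_pi_eval {n : ℕ} {μ : Measure ℝ} [IsProbabilityMeasure μ] (i : Fin n) {φ : ℝ → ℝ}
    (hφ : Measurable φ) :
    ∫ x, φ (x i) ∂(Measure.pi fun _ : Fin n => μ) = ∫ z, φ z ∂μ := by
  have h := measurePreserving_eval (fun _ : Fin n => μ) i
  conv_rhs => rw [← h.map_eq]
  rw [integral_map h.measurable.aemeasurable (by fun_prop)]

lemma integrable_pi_eval {n : ℕ} {μ : Measure ℝ} [IsProbabilityMeasure μ] (i : Fin n) {φ : ℝ → ℝ}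
    (hφ : Integrable φ μ) :
    Integrable (fun x => φ (x i)) (Measure.pi fun _ : Fin n => μ) :=
  (measurePreserving_eval (fun _ : Fin n => μ) i).integrable_comp_of_integrable hφ

lemma MomentBound.sqrt_le_integral_abs {α : Type*} [MeasurableSpace α] {ρ : Measure α}
    [IsProbabilityMeasure ρ] {u : α → ℝ} {F : ℝ} (h : MomentBound ρ u F 16) :
    √F / 16 ≤ ∫ y, |u y| ∂ρ := by
  have hm := h.measurable
  have h2 := integrable_sq_of_fourth hm h.integrable
  have h1 : Integrable (fun y => |u y|) ρ := by
    refine Integrable.mono' (h2.add (integrable_const 1)) (by fun_prop)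
      (Filter.Eventually.of_forall fun y => ?_)
    simp only [Pi.add_apply, Real.norm_eq_abs, abs_abs]
    nlinarith [sq_nonneg (|u y| - 1), sq_abs (u y), abs_nonneg (u y)]
  have hF : 0 ≤ F := h.second ▸ integral_nonneg fun _ => by positivity
  rcases hF.eq_or_lt with h0 | hF
  · rw [← h0]
    simpa using integral_nonneg fun y => abs_nonneg (u y)
  set s := 16 * √F with hs
  have hs0 : 0 < s := by positivity
  have hsq : s ^ 2 = 256 * F := by rw [hs, mul_pow, Real.sq_sqrt hF.le]; norm_num
  have pw : ∀ y, 3 * s ^ 2 * u y ^ 2 - u y ^ 4 ≤ 2 * s ^ 3 * |u y| := by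
    intro y
    have : u y ^ 4 = |u y| ^ 4 := by rw [← abs_pow, abs_of_nonneg (by positivity)]
    rw [this, ← sq_abs (u y)]
    have := abs_nonneg (u y)
    have : 0 ≤ |u y| * (|u y| - s) ^ 2 * (|u y| + 2 * s) := by positivity
    nlinarith
  have hintg := integral_mono ((h2.const_mul (3 * s ^ 2)).sub h.integrable)
    (h1.const_mul (2 * s ^ 3)) pw
  simp only [Pi.sub_apply] at hintg
  rw [integral_sub (h2.const_mul _) h.integrable, integral_const_mul, integral_const_mul,
    h.second] at hintg
  have h4 := h.fourth
  have : 2 * s ^ 3 * (√F / 16) ≤ 2 * s ^ 3 * ∫ y, |u y| ∂ρ := by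
    refine le_trans ?_ hintg
    have : s ^ 3 * (√F / 16) = s ^ 4 / 256 := by rw [hs]; ring
    have h5 : s ^ 4 = (256 * F) ^ 2 := by rw [← hsq]; ring
    rw [mul_assoc, this, h5, hsq]
    nlinarith
  exact le_of_mul_le_mul_left this (by positivity)

/-- A lower bound for the probability that `|Y|` exceeds half of its mean. -/
lemma paley_zygmund {α : Type*} [MeasurableSpace α] {ρ : Measure α} [IsProbabilityMeasure ρ]
    {Y : α → ℝ} (hY : Measurable Y) (hY2 : Integrable (fun y => Y y ^ 2) ρ) {c K : ℝ}
    (hc : 0 < c) (hK : 0 < K) (hmean : 2 * c ≤ ∫ y, |Y y| ∂ρ) (hsec : ∫ y, Y y ^ 2 ∂ρ ≤ K) :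
    c ^ 2 / K ≤ ρ.real {y | c ≤ |Y y|} := by
  set S := {y | c ≤ |Y y|} with hS
  have hSm : MeasurableSet S := measurableSet_le measurable_const (by fun_prop)
  have hind : Integrable (S.indicator fun _ => (1 : ℝ)) ρ := (integrable_const 1).indicator hSm
  have h1 : Integrable (fun y => |Y y|) ρ := by
    refine Integrable.mono' (hY2.add (integrable_const 1)) (by fun_prop)
      (Filter.Eventually.of_forall fun y => ?_)
    simp only [Pi.add_apply, Real.norm_eq_abs, abs_abs]
    nlinarith [sq_nonneg (|Y y| - 1), sq_abs (Y y), abs_nonneg (Y y)]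
  have pw : ∀ y, 2 * K * c * |Y y| ≤ 2 * K * c ^ 2 + c ^ 2 * Y y ^ 2 +
      K ^ 2 * S.indicator (fun _ => (1 : ℝ)) y := by
    intro y
    by_cases hy : y ∈ S
    · rw [Set.indicator_of_mem hy, ← sq_abs (Y y)]
      nlinarith [sq_nonneg (c * |Y y| - K), mul_pos hK (mul_pos hc hc)]
    · rw [Set.indicator_of_notMem hy]
      have : |Y y| < c := by simpa [hS] using hy
      have : 2 * K * c * |Y y| ≤ 2 * K * c * c := by gcongr
      nlinarith [sq_nonneg (c * Y y)]
  have i1 : Integrable (fun y => 2 * K * c ^ 2 + c ^ 2 * Y y ^ 2) ρ :=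
    (integrable_const _).add (hY2.const_mul _)
  have i2 : Integrable (fun y => 2 * K * c ^ 2 + c ^ 2 * Y y ^ 2 +
      K ^ 2 * S.indicator (fun _ => (1 : ℝ)) y) ρ := i1.add (hind.const_mul _)
  have hintg := integral_mono (h1.const_mul (2 * K * c)) i2 pw
  rw [integral_add i1 (hind.const_mul _), integral_add (integrable_const _) (hY2.const_mul _),
    integral_const_mul, integral_const_mul (c ^ 2) (fun y => Y y ^ 2), integral_const_mul (K ^ 2),
    integral_indicator hSm] at hintg
  simp only [integral_const, smul_eq_mul, mul_one, probReal_univ, one_mul,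
    measureReal_restrict_apply_univ] at hintg
  rw [div_le_iff₀ hK]
  have h2 : 2 * K * c * (2 * c) ≤ 2 * K * c * ∫ y, |Y y| ∂ρ := by gcongr
  have h3 : c ^ 2 * ∫ y, Y y ^ 2 ∂ρ ≤ c ^ 2 * K := by gcongr
  have h4 : K * c ^ 2 ≤ K * (ρ.real S * K) := by nlinarith
  exact le_of_mul_le_mul_left h4 hK

lemma integrable_pi_mul {μ : Measure ℝ} (hμ : UnitMoments μ) {n : ℕ} (i j : Fin n) :
    Integrable (fun x : Fin n → ℝ => x i * x j) (Measure.pi fun _ => μ) := by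
  have := hμ.prob
  refine Integrable.mono' ((integrable_pi_eval i hμ.integrable_sq).add
    (integrable_pi_eval j hμ.integrable_sq)) (by fun_prop) (Filter.Eventually.of_forall fun x => ?_)
  simp only [Pi.add_apply, Real.norm_eq_abs]
  rw [abs_le]
  constructor <;> nlinarith [sq_nonneg (x i + x j), sq_nonneg (x i - x j)]

lemma integral_pi_mul {μ : Measure ℝ} (hμ : UnitMoments μ) {n : ℕ} {i j : Fin n} (hij : i ≠ j) :
    ∫ x, x i * x j ∂(Measure.pi fun _ : Fin n => μ) = 0 := by
  have := hμ.prob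
  have hi : Integrable (fun x : Fin n → ℝ => x i ^ 2) (Measure.pi fun _ => μ) :=
    integrable_pi_eval i hμ.integrable_sq
  have hj : Integrable (fun x : Fin n → ℝ => x j ^ 2) (Measure.pi fun _ => μ) :=
    integrable_pi_eval j hμ.integrable_sq
  have hsum : Integrable (fun x : Fin n → ℝ => x i ^ 2 + x j ^ 2) (Measure.pi fun _ => μ) :=
    hi.add hj
  have h := (momentBound_linear hμ n (Pi.single i 1 + Pi.single j 1)).second
  have e1 : ∀ x : Fin n → ℝ, (∑ k, (Pi.single i 1 + Pi.single j 1 : Fin n → ℝ) k * x k) ^ 2 =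
      x i ^ 2 + x j ^ 2 + 2 * (x i * x j) := by
    intro x
    simp only [Pi.add_apply, add_mul, Finset.sum_add_distrib, Pi.single_apply, ite_mul, one_mul,
      zero_mul, Finset.sum_ite_eq', Finset.mem_univ, if_true]
    ring
  have e2 : ∑ k, (Pi.single i 1 + Pi.single j 1 : Fin n → ℝ) k ^ 2 = 2 := by
    have : ∀ k, (Pi.single i 1 + Pi.single j 1 : Fin n → ℝ) k ^ 2 =
        (if k = i then 1 else 0) + (if k = j then 1 else 0) := by
      intro k
      by_cases h1 : k = i
      · subst h1; simp [hij]
      · by_cases h2 : k = j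
        · subst h2; simp [h1]
        · simp [h1, h2]
    simp only [this, Finset.sum_add_distrib, Finset.sum_ite_eq', Finset.mem_univ, if_true]
    norm_num
  simp only [e1, e2] at h
  rw [integral_add hsum ((integrable_pi_mul hμ i j).const_mul 2), integral_add hi hj,
    integral_const_mul, integral_pi_eval i (φ := fun z => z ^ 2) (by fun_prop),
    integral_pi_eval j (φ := fun z => z ^ 2) (by fun_prop), hμ.second] at h
  linarith

lemma quad_smallBall {μ : Measure ℝ} (hμ : UnitMoments μ) {n : ℕ} (hn : 0 < n)
    (H : Matrix (Fin n) (Fin n) ℝ) (h0 : ℝ) (hd : ∀ i, H i i = h0) (hs : ∀ i j, H i j = H j i)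
    (hpos : 0 < ∑ i, ∑ j, H i j ^ 2) :
    1 / 10000 ≤ (Measure.pi fun _ : Fin n => μ).real
      {x | √(∑ i, ∑ j, H i j ^ 2) / 50 ≤ |x ⬝ᵥ H.mulVec x|} := by
  have := hμ.prob
  set ρ := Measure.pi fun _ : Fin n => μ
  set O : Fin n → Fin n → ℝ := fun i j => if i = j then 0 else H i j with hO
  have hch := momentBound_chaos hμ n O (by simp [hO]) (fun i j => by
    simp only [hO, eq_comm (a := i), hs i j])
  set f : (Fin n → ℝ) → ℝ := fun x => ∑ i, ∑ j, O i j * x i * x j with hf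
  set o : ℝ := ∑ i, ∑ j, O i j ^ 2 with ho
  have ho0 : 0 ≤ o := by positivity
  have hsum : ∑ i, ∑ j, H i j ^ 2 = n * h0 ^ 2 + o := by
    have : ∀ i j, H i j ^ 2 = (if i = j then h0 ^ 2 else 0) + O i j ^ 2 := by
      intro i j
      by_cases h : i = j
      · subst h; simp [hO, hd]
      · simp [hO, h]
    simp only [this, Finset.sum_add_distrib, ho]
    simp
  have hY : ∀ x : Fin n → ℝ, x ⬝ᵥ H.mulVec x = h0 * ∑ i, x i ^ 2 + f x := by
    intro x
    have : ∀ i j, x i * (H i j * x j) = (if i = j then h0 * x i ^ 2 else 0) + O i j * x i * x j := by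
      intro i j
      by_cases h : i = j
      · subst h; simp [hO, hd]; ring
      · simp [hO, h]; ring
    simp only [dotProduct, mulVec, Finset.mul_sum, this, Finset.sum_add_distrib, hf]
    simp
  have hfm := hch.measurable
  have hf2 := integrable_sq_of_fourth hfm hch.integrable
  have hfi : Integrable f ρ := by
    refine Integrable.mono' (hf2.add (integrable_const 1)) (by fun_prop)
      (Filter.Eventually.of_forall fun y => ?_)
    simp only [Pi.add_apply, Real.norm_eq_abs]
    nlinarith [sq_nonneg (|f y| - 1), sq_abs (f y), abs_nonneg (f y)]
  have hx2 : ∀ i, Integrable (fun x : Fin n → ℝ => x i ^ 2) ρ := fun i =>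
    integrable_pi_eval i hμ.integrable_sq
  have hx4 : ∀ i, Integrable (fun x : Fin n → ℝ => x i ^ 4) ρ := fun i =>
    integrable_pi_eval i hμ.integrable
  have hq : Integrable (fun x : Fin n → ℝ => ∑ i, x i ^ 2) ρ := integrable_finsetSum _ fun i _ => hx2 i
  have hq4 : Integrable (fun x : Fin n → ℝ => ∑ i, x i ^ 4) ρ := integrable_finsetSum _ fun i _ => hx4 i
  have hqv : ∫ x, ∑ i, x i ^ 2 ∂ρ = n := by
    rw [integral_finsetSum _ fun i _ => hx2 i]
    simp [ρ, integral_pi_eval (μ := μ) _ (φ := fun z => z ^ 2) (by fun_prop), hμ.second]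
  have hq4v : ∫ x, ∑ i, x i ^ 4 ∂ρ ≤ 3 * n := by
    rw [integral_finsetSum _ fun i _ => hx4 i]
    simp only [ρ, integral_pi_eval (μ := μ) _ (φ := fun z => z ^ 4) (by fun_prop)]
    simp only [Finset.sum_const, Finset.card_univ, Fintype.card_fin, nsmul_eq_mul]
    rw [mul_comm]
    gcongr
    exact hμ.fourth
  have hxi : ∀ i j, Integrable (fun x : Fin n → ℝ => x i * x j) ρ := fun i j =>
    integrable_pi_mul hμ i j
  have hxx : ∀ i j, i ≠ j → ∫ x, x i * x j ∂ρ = 0 := fun i j hij => integral_pi_mul hμ hij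
  have hf0 : ∫ x, f x ∂ρ = 0 := by
    have hOi : ∀ i j, Integrable (fun x : Fin n → ℝ => O i j * x i * x j) ρ := fun i j => by
      simpa only [mul_assoc] using (hxi i j).const_mul (O i j)
    simp only [hf]
    rw [integral_finsetSum _ fun i _ => integrable_finsetSum _ fun j _ => hOi i j]
    refine Finset.sum_eq_zero fun i _ => ?_
    rw [integral_finsetSum _ fun j _ => hOi i j]
    refine Finset.sum_eq_zero fun j _ => ?_
    by_cases hij : i = j
    · simp [hO, hij]
    · simp only [mul_assoc, integral_const_mul, hxx i j hij, mul_zero]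
  set Y : (Fin n → ℝ) → ℝ := fun x => h0 * ∑ i, x i ^ 2 + f x with hYdef
  have hYm : Measurable Y := by fun_prop
  have hYi : Integrable Y ρ := (hq.const_mul h0).add hfi
  have pw : ∀ x, Y x ^ 2 ≤ 2 * h0 ^ 2 * n * ∑ i, x i ^ 4 + 2 * f x ^ 2 := by
    intro x
    have hcs : (∑ i, x i ^ 2) ^ 2 ≤ n * ∑ i, x i ^ 4 := by
      have := sq_sum_le_card_mul_sum_sq (s := Finset.univ) (f := fun i => x i ^ 2)
      simp only [Finset.card_univ, Fintype.card_fin, ← pow_mul] at this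
      simpa using this
    have : h0 ^ 2 * (∑ i, x i ^ 2) ^ 2 ≤ h0 ^ 2 * (n * ∑ i, x i ^ 4) := by gcongr
    simp only [hYdef]
    nlinarith [sq_nonneg (h0 * ∑ i, x i ^ 2 - f x)]
  have hbi : Integrable (fun x => 2 * h0 ^ 2 * n * ∑ i, x i ^ 4 + 2 * f x ^ 2) ρ :=
    (hq4.const_mul _).add (hf2.const_mul _)
  have hY2 : Integrable (fun x => Y x ^ 2) ρ := by
    refine Integrable.mono' hbi (by fun_prop) (Filter.Eventually.of_forall fun x => ?_)
    rw [Real.norm_eq_abs, abs_of_nonneg (by positivity)]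
    exact pw x
  have hY2v : ∫ x, Y x ^ 2 ∂ρ ≤ 6 * (n * h0) ^ 2 + 4 * o := by
    refine (integral_mono hY2 hbi pw).trans ?_
    rw [integral_add (hq4.const_mul _) (hf2.const_mul _), integral_const_mul, integral_const_mul,
      hch.second]
    have : 2 * h0 ^ 2 * n * ∫ x, ∑ i, x i ^ 4 ∂ρ ≤ 2 * h0 ^ 2 * n * (3 * n) := by gcongr
    nlinarith
  set M := ∫ x, |Y x| ∂ρ with hM
  have hM1 : n * |h0| ≤ M := by
    have h1 : ∫ x, Y x ∂ρ = n * h0 := by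
      simp only [hYdef]
      rw [integral_add (hq.const_mul h0) hfi, integral_const_mul, hqv, hf0]; ring
    calc n * |h0| = |∫ x, Y x ∂ρ| := by rw [h1, abs_mul, Nat.abs_cast]
      _ ≤ M := abs_integral_le_integral_abs
  have hM2 : √(2 * o) / 16 ≤ M + n * |h0| := by
    refine hch.sqrt_le_integral_abs.trans ?_
    calc ∫ x, |f x| ∂ρ ≤ ∫ x, (|Y x| + |h0| * ∑ i, x i ^ 2) ∂ρ := by
          refine integral_mono hfi.abs (hYi.abs.add (hq.const_mul _)) fun x => ?_
          have hnn : 0 ≤ ∑ i, x i ^ 2 := by positivity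
          have : f x = Y x - h0 * ∑ i, x i ^ 2 := by simp [hYdef]
          simp only
          rw [this]
          refine (abs_sub _ _).trans ?_
          rw [abs_mul, abs_of_nonneg hnn]
      _ = M + n * |h0| := by
          rw [integral_add hYi.abs (hq.const_mul _), integral_const_mul, hqv]; ring
  have hM3 : o ≤ 512 * M ^ 2 := by
    have h1 : √(2 * o) ≤ 32 * M := by linarith
    have h2 := Real.sq_sqrt (show 0 ≤ 2 * o by positivity)
    have h3 := Real.sqrt_nonneg (2 * o)
    nlinarith
  have hM0 : 0 ≤ M := le_trans (by positivity) hM1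
  have hM4 : (n * h0) ^ 2 ≤ M ^ 2 := by
    rw [← sq_abs, abs_mul, Nat.abs_cast]; gcongr
  have hn1 : (1 : ℝ) ≤ n := by exact_mod_cast hn
  have hfro : ∑ i, ∑ j, H i j ^ 2 ≤ 513 * M ^ 2 := by
    rw [hsum]; nlinarith [sq_nonneg h0]
  have hMpos : 0 < M := by
    rcases hM0.eq_or_lt with h | h
    · rw [← h] at hfro; norm_num at hfro; linarith
    · exact h
  have hpz := paley_zygmund hYm hY2 (c := M / 2) (K := 2054 * M ^ 2) (by positivity) (by positivity)
    (by linarith) (by linarith)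
  calc (1 : ℝ) / 10000 ≤ (M / 2) ^ 2 / (2054 * M ^ 2) := by
        rw [div_pow, div_div, mul_comm, ← div_div, div_le_div_iff₀ (by norm_num) (by positivity)]
        rw [div_mul_eq_mul_div, le_div_iff₀ (by positivity)]
        nlinarith
    _ ≤ _ := hpz
    _ ≤ _ := by
        refine measureReal_mono ?_ 
        intro x hx
        simp only [Set.mem_ofPred_eq] at hx ⊢
        rw [hY x]
        refine le_trans ?_ hx
        have : √(∑ i, ∑ j, H i j ^ 2) ≤ 25 * M := by
          rw [Real.sqrt_le_left (by positivity)]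
          nlinarith
        linarith

/-- The value of `z` when `|z| ≤ T`, and zero otherwise. -/
def cutoff (T z : ℝ) : ℝ := if |z| ≤ T then z else 0

lemma measurable_cutoff (T : ℝ) : Measurable (cutoff T) :=
  Measurable.ite (measurableSet_le (by fun_prop) measurable_const) measurable_id measurable_const

lemma abs_cutoff_le {T : ℝ} (hT : 0 ≤ T) (z : ℝ) : |cutoff T z| ≤ T := by
  unfold cutoff; split_ifs with h
  · exact h
  · simpa using hT

lemma integrable_exp_cutoff {μ : Measure ℝ} [IsProbabilityMeasure μ] {T b : ℝ} (hT : 0 ≤ T) :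
    Integrable (fun z => Real.exp (b * cutoff T z)) μ := by
  have := measurable_cutoff T
  refine Integrable.mono' (integrable_const (Real.exp (|b| * T))) (by fun_prop)
    (Filter.Eventually.of_forall fun z => ?_)
  rw [Real.norm_eq_abs, Real.abs_exp, Real.exp_le_exp]
  refine (le_abs_self _).trans ?_
  rw [abs_mul]
  gcongr
  exact abs_cutoff_le hT z

lemma integral_exp_cutoff_le {μ : Measure ℝ} (hμ : UnitMoments μ) {T l c : ℝ} (hT : 0 < T)
    (hl : 0 ≤ l) (hlT : l * T ≤ 1) (hc : |c| ≤ 1) :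
    ∫ z, Real.exp (l * c * cutoff T z) ∂μ ≤ Real.exp (l / T + l ^ 2) := by
  have := hμ.prob
  obtain ⟨hc1, hc2⟩ := abs_le.1 hc
  have pw : ∀ z, Real.exp (l * c * cutoff T z) ≤
      1 + l * c * z + (l / T + l ^ 2) * z ^ 2 := by
    intro z
    have hb : |l * c * cutoff T z| ≤ 1 := by
      rw [abs_mul, abs_mul, abs_of_nonneg hl]
      calc l * |c| * |cutoff T z| ≤ l * 1 * T := by gcongr; exact abs_cutoff_le hT.le z
        _ ≤ 1 := by linarith
    have h1 := (abs_le.1 (Real.abs_exp_sub_one_sub_id_le hb)).2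
    have hcc : c ^ 2 ≤ 1 := by nlinarith
    have hlt : 0 ≤ l / T := by positivity
    unfold cutoff at *
    split_ifs at * with h
    · have : (l * c * z) ^ 2 ≤ l ^ 2 * z ^ 2 := by
        have : (l * c * z) ^ 2 = c ^ 2 * (l ^ 2 * z ^ 2) := by ring
        rw [this]
        have h0 : 0 ≤ l ^ 2 * z ^ 2 := by positivity
        nlinarith
      nlinarith [mul_nonneg hlt (sq_nonneg z)]
    · have hz : T ≤ |z| := (not_le.1 h).le
      have h2 : |z| ≤ z ^ 2 / T := by
        rw [le_div_iff₀ hT, ← sq_abs z]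
        nlinarith [abs_nonneg z]
      have h3 : -|z| ≤ c * z := by
        have : |c * z| ≤ |z| := by
          rw [abs_mul]; nlinarith [abs_nonneg z]
        linarith [neg_abs_le (c * z)]
      have h4 : 0 ≤ l * (c * z + z ^ 2 / T) := mul_nonneg hl (by linarith)
      have h5 : l / T * z ^ 2 = l * (z ^ 2 / T) := by ring
      simp only [mul_zero, Real.exp_zero]
      nlinarith [sq_nonneg (l * z)]
  have i1 : Integrable (fun z : ℝ => 1 + l * c * z) μ :=
    (integrable_const _).add (hμ.integrable_id.const_mul _)
  have i2 : Integrable (fun z : ℝ => (l / T + l ^ 2) * z ^ 2) μ := hμ.integrable_sq.const_mul _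
  refine (integral_mono (integrable_exp_cutoff hT.le) (i1.add i2) pw).trans ?_
  simp only [Pi.add_apply]
  rw [integral_add i1 i2, integral_add (integrable_const _) (hμ.integrable_id.const_mul _),
    integral_const_mul, integral_const_mul, hμ.mean, hμ.second]
  simp only [integral_const, probReal_univ, smul_eq_mul, mul_one, mul_zero, add_zero]
  linarith [Real.add_one_le_exp (l / T + l ^ 2)]

lemma UnitMoments.tail_le {μ : Measure ℝ} (hμ : UnitMoments μ) {T : ℝ} (hT : 0 < T) :
    μ.real {z | T < |z|} ≤ 3 / T ^ 4 := by
  have := hμ.prob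
  have h := mul_meas_ge_le_integral_of_nonneg (μ := μ) (f := fun z : ℝ => z ^ 4)
    (Filter.Eventually.of_forall fun z => by positivity) hμ.integrable (T ^ 4)
  rw [le_div_iff₀ (by positivity), mul_comm]
  refine le_trans ?_ (h.trans hμ.fourth)
  refine mul_le_mul_of_nonneg_left (measureReal_mono ?_ (measure_ne_top _ _)) (by positivity)
  intro z hz
  simp only [Set.mem_ofPred_eq] at hz ⊢
  calc T ^ 4 ≤ |z| ^ 4 := by gcongr
    _ = z ^ 4 := by rw [← abs_pow, abs_of_nonneg (by positivity)]

lemma sum_inv_sq_le (n : ℕ) : ∑ k ∈ Finset.range n, 1 / ((k : ℝ) + 1) ^ 2 ≤ 2 - 1 / (n : ℝ) := by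
  induction n with
  | zero => simp
  | succ n ih =>
    rw [Finset.sum_range_succ]
    rcases Nat.eq_zero_or_pos n with h | h
    · subst h; norm_num [Finset.sum_range_zero]
    · have hn : (0 : ℝ) < n := by exact_mod_cast h
      have : 1 / ((n : ℝ) + 1) ^ 2 ≤ 1 / (n : ℝ) - 1 / ((n : ℝ) + 1) := by
        rw [div_sub_div _ _ (by positivity) (by positivity), div_le_div_iff₀ (by positivity)
          (by positivity)]
        nlinarith
      push_cast
      linarith

lemma sum_inv_sqrt_le (n : ℕ) : ∑ k ∈ Finset.range n, 1 / √((k : ℝ) + 1) ≤ 2 * √n := by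
  induction n with
  | zero => simp
  | succ n ih =>
    rw [Finset.sum_range_succ]
    have h1 : 0 < √((n : ℝ) + 1) := by positivity
    have h2 := Real.sq_sqrt (show (0 : ℝ) ≤ n by positivity)
    have h3 := Real.sq_sqrt (show (0 : ℝ) ≤ n + 1 by positivity)
    have : 1 / √((n : ℝ) + 1) ≤ 2 * √((n : ℝ) + 1) - 2 * √n := by
      rw [div_le_iff₀ h1]
      nlinarith [sq_nonneg (√((n : ℝ) + 1) - √n)]
    push_cast
    linarith

lemma sum_filter_perm_le {n : ℕ} (e : Equiv.Perm (Fin n)) (p : ℕ) {φ : ℕ → ℝ}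
    (hφ : ∀ k, 0 ≤ φ k) :
    ∑ l, (if (e l : ℕ) < p then φ (e l) else 0) ≤ ∑ k ∈ Finset.range p, φ k := by
  rw [Equiv.sum_comp e fun k : Fin n => if (k : ℕ) < p then φ k else 0,
    Fin.sum_univ_eq_sum_range (fun k => if k < p then φ k else 0), ← Finset.sum_filter]
  refine Finset.sum_le_sum_of_subset_of_nonneg ?_ fun k _ _ => hφ k
  intro k hk
  simp only [Finset.mem_filter] at hk
  simpa using hk.2

lemma partialSum_cutoff_tail {μ : Measure ℝ} (hμ : UnitMoments μ) {n : ℕ} (e : Equiv.Perm (Fin n))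
    {c : Fin n → ℝ} (hc : ∀ i, |c i| ≤ 1) {p : ℕ} (hp : 1 ≤ p) (t : ℝ) :
    (Measure.pi fun _ : Fin n => μ).real {x | t * √p ≤
      ∑ l, if (e l : ℕ) < p then c l * cutoff (30 * √((e l : ℕ) + 1)) (x l) else 0} ≤
      Real.exp (1 - t / 30) := by
  have := hμ.prob
  have hp0 : (0 : ℝ) < p := by exact_mod_cast hp
  have hsp : 0 < √(p : ℝ) := Real.sqrt_pos.2 hp0
  set l0 : ℝ := 1 / (30 * √p) with hl0
  have hl0p : 0 < l0 := by positivity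
  set T : Fin n → ℝ := fun l => 30 * √((e l : ℕ) + 1) with hT
  have hTp : ∀ l, 0 < T l := fun l => by positivity
  set g : Fin n → ℝ → ℝ := fun l z => Real.exp (l0 * (if (e l : ℕ) < p then c l else 0) *
    cutoff (T l) z) with hg
  have hexp : ∀ x : Fin n → ℝ, Real.exp (l0 * ∑ l, if (e l : ℕ) < p then c l * cutoff (T l) (x l)
      else 0) = ∏ l, g l (x l) := by
    intro x
    rw [← Real.exp_sum, Finset.mul_sum]
    congr 1
    refine Finset.sum_congr rfl fun l _ => ?_
    split_ifs <;> ring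
  have hgi : ∀ l, Integrable (g l) μ := fun l => integrable_exp_cutoff (hTp l).le
  have hintg : Integrable (fun x : Fin n → ℝ => ∏ l, g l (x l)) (Measure.pi fun _ => μ) :=
    Integrable.fintype_prod hgi
  have hgv : ∀ l, ∫ z, g l z ∂μ ≤ Real.exp (if (e l : ℕ) < p then l0 / T l + l0 ^ 2 else 0) := by
    intro l
    simp only [hg]
    split_ifs with h
    · refine integral_exp_cutoff_le hμ (hTp l) hl0p.le ?_ (hc l)
      simp only [hl0, hT]
      rw [div_mul_eq_mul_div, one_mul, div_le_one (by positivity)]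
      gcongr
      exact_mod_cast h
    · simp
  have h := measure_ge_le_exp_mul_mgf (μ := Measure.pi fun _ : Fin n => μ)
    (X := fun x => ∑ l, if (e l : ℕ) < p then c l * cutoff (T l) (x l) else 0)
    (t * √p) hl0p.le (by simpa only [hexp] using hintg)
  refine h.trans ?_
  simp only [mgf, hexp]
  rw [integral_fintype_prod_eq_prod (μ := fun _ => μ) (fun l => g l)]
  have hprod : ∏ l, ∫ z, g l z ∂μ ≤ Real.exp 1 := by
    calc ∏ l, ∫ z, g l z ∂μ
        ≤ ∏ l, Real.exp (if (e l : ℕ) < p then l0 / T l + l0 ^ 2 else 0) :=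
          Finset.prod_le_prod (fun l _ => integral_nonneg fun z => (Real.exp_pos _).le)
            fun l _ => hgv l
      _ = Real.exp (∑ l, if (e l : ℕ) < p then l0 / T l + l0 ^ 2 else 0) := (Real.exp_sum _ _).symm
      _ ≤ Real.exp 1 := by
          rw [Real.exp_le_exp]
          refine (sum_filter_perm_le e p (φ := fun k => l0 / (30 * √((k : ℝ) + 1)) + l0 ^ 2)
            fun k => by positivity).trans ?_
          have h1 : ∀ k : ℕ, l0 / (30 * √((k : ℝ) + 1)) = l0 / 30 * (1 / √((k : ℝ) + 1)) := by
            intro k; field_simp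
          simp only [h1, Finset.sum_add_distrib, ← Finset.mul_sum, Finset.sum_const,
            Finset.card_range, nsmul_eq_mul]
          have h2 := sum_inv_sqrt_le p
          have h3 : l0 / 30 * ∑ k ∈ Finset.range p, 1 / √((k : ℝ) + 1) ≤ l0 / 30 * (2 * √p) := by
            gcongr
          have h4 : l0 * √p = 1 / 30 := by rw [hl0]; field_simp
          have h5 : p * l0 ^ 2 = (l0 * √p) ^ 2 := by
            rw [mul_pow, Real.sq_sqrt hp0.le]; ring
          rw [h5, h4]
          nlinarith
  calc Real.exp (-l0 * (t * √p)) * ∏ l, ∫ z, g l z ∂μ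
      ≤ Real.exp (-l0 * (t * √p)) * Real.exp 1 := by gcongr
    _ = Real.exp (1 - t / 30) := by
        rw [← Real.exp_add]
        congr 1
        rw [hl0]; field_simp; ring

lemma partialSum_tail {μ : Measure ℝ} (hμ : UnitMoments μ) {n : ℕ} (e : Equiv.Perm (Fin n))
    {Θ : Type*} [Fintype Θ] {c : Θ → Fin n → ℝ} (hc : ∀ κ i, |c κ i| ≤ 1) (t : ℝ) :
    (Measure.pi fun _ : Fin n => μ).real {x | ∃ κ : Θ, ∃ p ∈ Finset.Icc 1 n,
      t * √(p : ℝ) < |∑ l, if (e l : ℕ) < p then c κ l * x l else 0|} ≤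
      6 / 30 ^ 4 + 2 * Fintype.card Θ * n * Real.exp (1 - t / 30) := by
  have := hμ.prob
  set ρ := Measure.pi fun _ : Fin n => μ
  set T : Fin n → ℝ := fun l => 30 * √((e l : ℕ) + 1) with hT
  set S : (Fin n → ℝ) → ℕ → Set (Fin n → ℝ) := fun b p => {x | t * √(p : ℝ) ≤
      ∑ l, if (e l : ℕ) < p then b l * cutoff (T l) (x l) else 0} with hS
  have hsub : {x : Fin n → ℝ | ∃ κ : Θ, ∃ p ∈ Finset.Icc 1 n,
      t * √(p : ℝ) < |∑ l, if (e l : ℕ) < p then c κ l * x l else 0|} ⊆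
      (⋃ l, {x | T l < |x l|}) ∪ ⋃ κ : Θ, ⋃ p ∈ Finset.Icc 1 n, (S (c κ) p ∪ S (-c κ) p) := by
    rintro x ⟨κ, p, hp, hx⟩
    by_cases hcut : ∃ l, T l < |x l|
    · exact Or.inl (by simpa using hcut)
    · push Not at hcut
      have hxe : ∀ l, cutoff (T l) (x l) = x l := fun l => if_pos (hcut l)
      refine Or.inr ?_
      simp only [Set.mem_iUnion]
      refine ⟨κ, p, hp, ?_⟩
      simp only [hS, Set.mem_union, Set.mem_ofPred_eq, hxe, Pi.neg_apply, neg_mul]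
      rcases lt_abs.1 hx with h | h
      · exact Or.inl h.le
      · right
        refine h.le.trans (le_of_eq ?_)
        rw [← Finset.sum_neg_distrib]
        refine Finset.sum_congr rfl fun l _ => ?_
        split_ifs <;> simp
  refine (measureReal_mono hsub).trans ((measureReal_union_le _ _).trans (add_le_add ?_ ?_))
  · refine (measureReal_iUnion_fintype_le _).trans ?_
    have h1 : ∀ l, ρ.real {x | T l < |x l|} ≤ 3 / T l ^ 4 := by
      intro l
      refine le_trans (le_of_eq ?_) (hμ.tail_le (T := T l) (by positivity))
      exact (measurePreserving_eval (fun _ : Fin n => μ) l).measureReal_preimage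
        (measurableSet_lt (measurable_const (a := T l)) measurable_id.abs :
          MeasurableSet {z : ℝ | T l < |z|}).nullMeasurableSet
    calc _ ≤ ∑ l, 3 / T l ^ 4 := Finset.sum_le_sum fun l _ => h1 l
      _ = 3 / 30 ^ 4 * ∑ l, (if (e l : ℕ) < n then 1 / (((e l : ℕ) : ℝ) + 1) ^ 2 else 0) := by
          rw [Finset.mul_sum]
          refine Finset.sum_congr rfl fun l _ => ?_
          rw [if_pos (e l).2]
          have : T l ^ 4 = 30 ^ 4 * (((e l : ℕ) : ℝ) + 1) ^ 2 := by
            simp only [hT, mul_pow]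
            rw [show √(((e l : ℕ) : ℝ) + 1) ^ 4 = (√(((e l : ℕ) : ℝ) + 1) ^ 2) ^ 2 by ring,
              Real.sq_sqrt (by positivity)]
          rw [this]
          field_simp
      _ ≤ 3 / 30 ^ 4 * 2 := by
          gcongr
          refine (sum_filter_perm_le e n (φ := fun k => 1 / ((k : ℝ) + 1) ^ 2)
            fun k => by positivity).trans ?_
          have := sum_inv_sq_le n
          have : (0 : ℝ) ≤ 1 / n := by positivity
          linarith
      _ = _ := by norm_num
  · refine (measureReal_iUnion_fintype_le _).trans ?_
    calc _ ≤ ∑ κ : Θ, ∑ p ∈ Finset.Icc 1 n, 2 * Real.exp (1 - t / 30) := by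
          refine Finset.sum_le_sum fun κ _ => ?_
          refine (measureReal_biUnion_finset_le _ _).trans (Finset.sum_le_sum fun p hp => ?_)
          have hp1 := (Finset.mem_Icc.1 hp).1
          have h1 := partialSum_cutoff_tail hμ e (hc κ) hp1 t
          have h2 := partialSum_cutoff_tail hμ e (c := -c κ) (by simpa using hc κ) hp1 t
          refine (measureReal_union_le _ _).trans ?_
          rw [two_mul]
          exact add_le_add h1 h2
      _ = _ := by
          simp only [Finset.sum_const, Nat.card_Icc, Finset.card_univ, nsmul_eq_mul,
            Nat.add_sub_cancel]
          ring

/-- Sum of the first `q` entries of `b`. -/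
def prefixSum {n : ℕ} (b : Fin n → ℝ) (q : ℕ) : ℝ := ∑ l : Fin n, if (l : ℕ) < q then b l else 0

/-- Sum of the last `p` entries of `b`. -/
def suffixSum {n : ℕ} (b : Fin n → ℝ) (p : ℕ) : ℝ := ∑ j : Fin n, if (j.rev : ℕ) < p then b j else 0

lemma sum_window_count (D i l : ℕ) :
    ∑ p ∈ Finset.range D, (if i < p then if l < D - p then (1 : ℝ) else 0 else 0) =
      ((D - (i + l + 1) : ℕ) : ℝ) := by
  have h : ∀ p ∈ Finset.range D, (if i < p then if l < D - p then (1 : ℝ) else 0 else 0) =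
      if p ∈ Finset.Ioo i (D - l) then 1 else 0 := by
    intro p hp
    simp only [Finset.mem_range] at hp
    rw [← ite_and]
    refine if_congr ?_ rfl rfl
    rw [Finset.mem_Ioo]
    omega
  rw [Finset.sum_congr rfl h, Finset.sum_ite_mem, Finset.inter_eq_right.2]
  · simp only [Finset.sum_const, Nat.card_Ioo, nsmul_eq_mul, mul_one]
    congr 1
    omega
  · intro p hp
    simp only [Finset.mem_Ioo, Finset.mem_range] at hp ⊢
    omega

lemma sum_suffixSum_mul_prefixSum {n : ℕ} (b b' : Fin n → ℝ) (D : ℕ) :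
    ∑ p ∈ Finset.range D, suffixSum b p * prefixSum b' (D - p) =
      ∑ j, ∑ l, b j * b' l * ((D - (n - j + l) : ℕ) : ℝ) := by
  have h : ∀ j l : Fin n, b j * b' l * ((D - (n - j + l) : ℕ) : ℝ) = ∑ p ∈ Finset.range D,
      (if (j.rev : ℕ) < p then b j else 0) * (if (l : ℕ) < D - p then b' l else 0) := by
    intro j l
    have e : n - (j : ℕ) + l = j.rev + l + 1 := by
      rw [Fin.val_rev]; omega
    rw [e, ← sum_window_count, Finset.mul_sum]
    refine Finset.sum_congr rfl fun p _ => ?_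
    split_ifs <;> simp
  simp only [h, suffixSum, prefixSum, Finset.sum_mul_sum]
  rw [Finset.sum_comm]
  refine Finset.sum_congr rfl fun j _ => ?_
  rw [Finset.sum_comm]

/-- Weights of the discrete decomposition of `d ↦ 2 / d - 2 / n` into ramps. -/
def rampWeight (D : ℕ) : ℝ := 4 / (((D : ℝ) - 1) * D * (D + 1))

/-- Ramp decomposition of `d ↦ 2 / d - 2 / n`. -/
def rampSum (n d : ℕ) : ℝ :=
  ∑ D ∈ Finset.range n, rampWeight D * ((D - d : ℕ) : ℝ) +
    2 / ((n : ℝ) * (n - 1)) * ((n - d : ℕ) : ℝ)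

lemma rampSum_of_le {n d : ℕ} (h : n ≤ d) : rampSum n d = 0 := by
  unfold rampSum
  rw [Finset.sum_eq_zero, Nat.sub_eq_zero_of_le h]
  · simp
  · intro D hD
    rw [Finset.mem_range] at hD
    rw [Nat.sub_eq_zero_of_le (by omega)]
    simp

lemma rampSum_succ {n d : ℕ} (hn : 2 ≤ n) (hd : d ≤ n) :
    rampSum (n + 1) d = rampSum n d + (2 / (n : ℝ) - 2 / ((n : ℝ) + 1)) := by
  unfold rampSum rampWeight
  rw [Finset.sum_range_succ, Nat.cast_sub hd, Nat.cast_sub (by omega)]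
  push_cast
  have h1 : (2 : ℝ) ≤ n := by exact_mod_cast hn
  have h2 : (n : ℝ) - 1 ≠ 0 := by intro h; linarith
  have h3 : (n : ℝ) + 1 ≠ 0 := by positivity
  have h4 : (n : ℝ) ≠ 0 := by positivity
  have h5 : (n : ℝ) + 1 - 1 = n := by ring
  rw [h5, add_assoc, add_assoc]
  congr 1
  field_simp
  ring

lemma rampSum_eq {n d : ℕ} (hn : 2 ≤ n) (hd : 1 ≤ d) (hdn : d ≤ n) :
    rampSum n d = 2 / (d : ℝ) - 2 / n := by
  rcases Nat.lt_or_ge d 2 with h | h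
  · obtain rfl : d = 1 := by omega
    induction n, hn using Nat.le_induction with
    | base => norm_num [rampSum, rampWeight, Finset.sum_range_succ]
    | succ k hk ih =>
      rw [rampSum_succ hk (by omega), ih (by omega)]
      push_cast; ring
  · clear hn
    induction n, hdn using Nat.le_induction with
    | base => rw [rampSum_of_le le_rfl]; ring
    | succ k hk ih =>
      rw [rampSum_succ (h.trans hk) hk, ih]
      push_cast; ring

/-- The kernel of the frequency functional. -/
def freqKernel (n j l : ℕ) : ℝ := 1 / (n : ℝ) + rampSum n (n - j + l)

lemma freqKernel_add_swap_of_le {n j l : ℕ} (hn : 2 ≤ n) (hj : j < n) (hl : l ≤ j) :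
    freqKernel n j l + freqKernel n l j = 2 / ((n : ℝ) - |(j : ℝ) - l|) := by
  unfold freqKernel
  rw [rampSum_eq hn (by omega) (by omega), rampSum_of_le (d := n - l + j) (by omega)]
  have h1 : ((n - j + l : ℕ) : ℝ) = (n : ℝ) - |(j : ℝ) - l| := by
    have : (l : ℝ) ≤ j := by exact_mod_cast hl
    rw [abs_of_nonneg (by linarith)]
    push_cast [Nat.cast_sub hj.le]
    ring
  rw [h1]
  ring

lemma freqKernel_add_swap {n : ℕ} (hn : 2 ≤ n) (j l : Fin n) :
    freqKernel n j l + freqKernel n l j = 2 / ((n : ℝ) - |(j : ℝ) - l|) := by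
  rcases le_total (l : ℕ) j with h | h
  · exact freqKernel_add_swap_of_le hn j.2 h
  · rw [add_comm, abs_sub_comm]
    exact freqKernel_add_swap_of_le hn l.2 h

/-- The vector `x` modulated by `cos (θ l)`. -/
def cosMod {n : ℕ} (θ : ℝ) (x : Fin n → ℝ) (l : Fin n) : ℝ := Real.cos (θ * l) * x l

/-- The vector `x` modulated by `sin (θ l)`. -/
def sinMod {n : ℕ} (θ : ℝ) (x : Fin n → ℝ) (l : Fin n) : ℝ := Real.sin (θ * l) * x l

/-- Product of a modulated suffix sum with a modulated prefix sum. -/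
def windowProd {n : ℕ} (θ : ℝ) (x : Fin n → ℝ) (p q : ℕ) : ℝ :=
  suffixSum (cosMod θ x) p * prefixSum (cosMod θ x) q +
    suffixSum (sinMod θ x) p * prefixSum (sinMod θ x) q

/-- The quadratic functional attached to the frequency `θ`. -/
def freqForm {n : ℕ} (θ : ℝ) (x : Fin n → ℝ) : ℝ :=
  1 / (n : ℝ) * windowProd θ x n n +
    (∑ D ∈ Finset.range n, rampWeight D * ∑ p ∈ Finset.range D, windowProd θ x p (D - p) +
      2 / ((n : ℝ) * (n - 1)) * ∑ p ∈ Finset.range n, windowProd θ x p (n - p))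

lemma cosMod_mul_add_sinMod_mul {n : ℕ} (θ : ℝ) (x : Fin n → ℝ) (j l : Fin n) :
    cosMod θ x j * cosMod θ x l + sinMod θ x j * sinMod θ x l =
      x j * x l * Real.cos (θ * ((j : ℝ) - l)) := by
  unfold cosMod sinMod
  rw [mul_sub, Real.cos_sub]
  ring

lemma sum_windowProd {n : ℕ} (θ : ℝ) (x : Fin n → ℝ) (D : ℕ) :
    ∑ p ∈ Finset.range D, windowProd θ x p (D - p) =
      ∑ j : Fin n, ∑ l : Fin n,
        x j * x l * Real.cos (θ * ((j : ℝ) - l)) * ((D - (n - j + l) : ℕ) : ℝ) := by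
  unfold windowProd
  rw [Finset.sum_add_distrib, sum_suffixSum_mul_prefixSum, sum_suffixSum_mul_prefixSum,
    ← Finset.sum_add_distrib]
  refine Finset.sum_congr rfl fun j _ => ?_
  rw [← Finset.sum_add_distrib]
  refine Finset.sum_congr rfl fun l _ => ?_
  rw [← cosMod_mul_add_sinMod_mul]
  ring

lemma prefixSum_self {n : ℕ} (b : Fin n → ℝ) : prefixSum b n = ∑ l, b l := by
  simp [prefixSum]

lemma suffixSum_self {n : ℕ} (b : Fin n → ℝ) : suffixSum b n = ∑ l, b l := by
  simp only [suffixSum, Fin.is_lt, if_true]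

lemma windowProd_self {n : ℕ} (θ : ℝ) (x : Fin n → ℝ) :
    windowProd θ x n n = ∑ j : Fin n, ∑ l : Fin n,
        x j * x l * Real.cos (θ * ((j : ℝ) - l)) := by
  unfold windowProd
  simp only [prefixSum_self, suffixSum_self, Finset.sum_mul_sum, ← Finset.sum_add_distrib,
    cosMod_mul_add_sinMod_mul]

lemma freqForm_eq_sum {n : ℕ} (θ : ℝ) (x : Fin n → ℝ) :
    freqForm θ x = ∑ j : Fin n, ∑ l : Fin n,
        x j * x l * Real.cos (θ * ((j : ℝ) - l)) * freqKernel n j l := by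
  unfold freqForm
  simp only [sum_windowProd, windowProd_self, freqKernel, rampSum, mul_add, Finset.sum_add_distrib,
    Finset.mul_sum]
  congr 1
  · exact Finset.sum_congr rfl fun j _ => Finset.sum_congr rfl fun l _ => by ring
  congr 1
  · rw [Finset.sum_comm]
    refine Finset.sum_congr rfl fun j _ => ?_
    rw [Finset.sum_comm]
    exact Finset.sum_congr rfl fun l _ => Finset.sum_congr rfl fun D _ => by ring
  · exact Finset.sum_congr rfl fun j _ => Finset.sum_congr rfl fun l _ => by ring

lemma abs_windowProd_le {n : ℕ} {θ ℓ : ℝ} {x : Fin n → ℝ}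
    (hc : ∀ q ≤ n, |prefixSum (cosMod θ x) q| ≤ ℓ * √q)
    (hs : ∀ q ≤ n, |prefixSum (sinMod θ x) q| ≤ ℓ * √q)
    (hc' : ∀ q ≤ n, |suffixSum (cosMod θ x) q| ≤ ℓ * √q)
    (hs' : ∀ q ≤ n, |suffixSum (sinMod θ x) q| ≤ ℓ * √q) {p q : ℕ} (hp : p ≤ n) (hq : q ≤ n) :
    |windowProd θ x p q| ≤ ℓ ^ 2 * (p + q) := by
  have h1 : |suffixSum (cosMod θ x) p * prefixSum (cosMod θ x) q| ≤ (ℓ * √p) * (ℓ * √q) := by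
    rw [abs_mul]
    exact mul_le_mul (hc' p hp) (hc q hq) (abs_nonneg _) ((abs_nonneg _).trans (hc' p hp))
  have h2 : |suffixSum (sinMod θ x) p * prefixSum (sinMod θ x) q| ≤ (ℓ * √p) * (ℓ * √q) := by
    rw [abs_mul]
    exact mul_le_mul (hs' p hp) (hs q hq) (abs_nonneg _) ((abs_nonneg _).trans (hs' p hp))
  refine (abs_add_le _ _).trans ((add_le_add h1 h2).trans ?_)
  have e1 := Real.sq_sqrt (show (0 : ℝ) ≤ p by positivity)
  have e2 := Real.sq_sqrt (show (0 : ℝ) ≤ q by positivity)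
  have : 2 * (√(p : ℝ) * √(q : ℝ)) ≤ p + q := by nlinarith [sq_nonneg (√(p : ℝ) - √(q : ℝ))]
  nlinarith [sq_nonneg ℓ]

lemma rampWeight_nonneg (D : ℕ) : 0 ≤ rampWeight D := by
  unfold rampWeight
  rcases D with _ | D
  · simp
  · push_cast
    rw [add_sub_cancel_right]
    positivity

lemma sum_rampWeight_le {n : ℕ} (hn : 1 ≤ n) :
    ∑ D ∈ Finset.range n, rampWeight D * (D : ℝ) ^ 2 ≤ 8 * Real.log n := by
  induction n, hn using Nat.le_induction with
  | base => simp
  | succ k hk ih =>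
    rw [Finset.sum_range_succ]
    have hk0 : (0 : ℝ) < k := by exact_mod_cast hk
    have hlog : 1 / ((k : ℝ) + 1) ≤ Real.log (k + 1) - Real.log k := by
      rw [← Real.log_div (by positivity) (by positivity)]
      have := Real.one_sub_inv_le_log_of_pos (show 0 < ((k : ℝ) + 1) / k by positivity)
      refine le_trans (le_of_eq ?_) this
      field_simp; ring
    have h2 : rampWeight k * (k : ℝ) ^ 2 ≤ 8 * (1 / ((k : ℝ) + 1)) := by
      unfold rampWeight
      rcases Nat.lt_or_ge k 2 with h | h
      · obtain rfl : k = 1 := by omega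
        norm_num
      · have h3 : (2 : ℝ) ≤ k := by exact_mod_cast h
        have h4 : 0 < (k : ℝ) - 1 := by linarith
        rw [div_mul_eq_mul_div, div_le_iff₀ (by positivity)]
        have : 8 * (1 / ((k : ℝ) + 1)) * (((k : ℝ) - 1) * k * (k + 1)) = 8 * ((k - 1) * k) := by
          field_simp
        rw [this]
        nlinarith
    push_cast
    linarith

lemma abs_freqForm_le {n : ℕ} (hn : 2 ≤ n) {θ ℓ : ℝ} {x : Fin n → ℝ}
    (hc : ∀ q ≤ n, |prefixSum (cosMod θ x) q| ≤ ℓ * √q)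
    (hs : ∀ q ≤ n, |prefixSum (sinMod θ x) q| ≤ ℓ * √q)
    (hc' : ∀ q ≤ n, |suffixSum (cosMod θ x) q| ≤ ℓ * √q)
    (hs' : ∀ q ≤ n, |suffixSum (sinMod θ x) q| ≤ ℓ * √q) :
    |freqForm θ x| ≤ 17 * ℓ ^ 2 * Real.log n := by
  have hw {p q : ℕ} (hp : p ≤ n) (hq : q ≤ n) : |windowProd θ x p q| ≤ ℓ ^ 2 * (p + q) :=
    abs_windowProd_le hc hs hc' hs' hp hq
  have hn2 : (2 : ℝ) ≤ n := by exact_mod_cast hn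
  have hsum : ∀ D ≤ n, |∑ p ∈ Finset.range D, windowProd θ x p (D - p)| ≤ ℓ ^ 2 * (D : ℝ) ^ 2 := by
    intro D hD
    refine (Finset.abs_sum_le_sum_abs _ _).trans ?_
    calc _ ≤ ∑ p ∈ Finset.range D, ℓ ^ 2 * (D : ℝ) := by
          refine Finset.sum_le_sum fun p hp => ?_
          rw [Finset.mem_range] at hp
          refine (hw (by omega) (by omega)).trans (le_of_eq ?_)
          rw [Nat.cast_sub hp.le]; ring
      _ = _ := by simp; ring
  have h1 : |1 / (n : ℝ) * windowProd θ x n n| ≤ 2 * ℓ ^ 2 := by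
    rw [abs_mul, abs_of_nonneg (by positivity)]
    calc 1 / (n : ℝ) * |windowProd θ x n n| ≤ 1 / n * (ℓ ^ 2 * (n + n)) := by
          gcongr; exact hw le_rfl le_rfl
      _ = _ := by field_simp; ring
  have h2 : |∑ D ∈ Finset.range n, rampWeight D * ∑ p ∈ Finset.range D, windowProd θ x p (D - p)| ≤
      ℓ ^ 2 * (8 * Real.log n) := by
    refine (Finset.abs_sum_le_sum_abs _ _).trans ?_
    calc _ ≤ ∑ D ∈ Finset.range n, ℓ ^ 2 * (rampWeight D * (D : ℝ) ^ 2) := by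
          refine Finset.sum_le_sum fun D hD => ?_
          rw [Finset.mem_range] at hD
          rw [abs_mul, abs_of_nonneg (rampWeight_nonneg D)]
          have := mul_le_mul_of_nonneg_left (hsum D hD.le) (rampWeight_nonneg D)
          linarith
      _ ≤ _ := by
          rw [← Finset.mul_sum]
          gcongr
          exact sum_rampWeight_le (by omega)
  have h3 : |2 / ((n : ℝ) * (n - 1)) * ∑ p ∈ Finset.range n, windowProd θ x p (n - p)| ≤
      4 * ℓ ^ 2 := by
    have hn1 : 0 < (n : ℝ) - 1 := by linarith
    rw [abs_mul, abs_of_nonneg (by positivity)]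
    calc _ ≤ 2 / ((n : ℝ) * (n - 1)) * (ℓ ^ 2 * (n : ℝ) ^ 2) := by
          gcongr; exact hsum n le_rfl
      _ = (2 * n / (n - 1)) * ℓ ^ 2 := by field_simp
      _ ≤ 4 * ℓ ^ 2 := by
          gcongr
          rw [div_le_iff₀ hn1]; linarith
  have hlog : 2 / 3 ≤ Real.log n := by
    have : Real.log 2 ≤ Real.log n := Real.log_le_log (by norm_num) hn2
    linarith [Real.log_two_gt_d9]
  unfold freqForm
  refine (abs_add_le _ _).trans ((add_le_add h1 ((abs_add_le _ _).trans (add_le_add h2 h3))).trans ?_)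
  nlinarith [mul_le_mul_of_nonneg_left hlog (sq_nonneg ℓ)]

/-- The equispaced frequencies `π t / n`. -/
def freq (n t : ℕ) : ℝ := Real.pi * t / n

lemma two_sin_mul_sum_cos (α : ℝ) (N : ℕ) :
    2 * Real.sin (α / 2) * ∑ t ∈ Finset.range N, Real.cos (t * α) =
      Real.sin (N * α - α / 2) + Real.sin (α / 2) := by
  induction N with
  | zero => simp
  | succ N ih =>
    rw [Finset.sum_range_succ, mul_add, ih]
    have e : ((N + 1 : ℕ) : ℝ) * α - α / 2 = N * α + α / 2 := by push_cast; ring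
    rw [e, Real.sin_sub, Real.sin_add]
    ring

lemma sum_cos_freq {n : ℕ} (hn : 1 ≤ n) {k : ℤ} (hk : |k| < 2 * n) :
    ∑ t : Fin (2 * n), Real.cos (freq n t * k) = if k = 0 then 2 * (n : ℝ) else 0 := by
  have hn0 : (0 : ℝ) < n := by exact_mod_cast hn
  split_ifs with h
  · subst h; simp
  · set α : ℝ := Real.pi * k / n with hα
    have e : ∀ t : ℕ, Real.cos (freq n t * k) = Real.cos (t * α) := by
      intro t; congr 1; rw [hα, freq]; ring
    simp only [e]
    rw [Fin.sum_univ_eq_sum_range (fun t => Real.cos (t * α))]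
    have h1 := two_sin_mul_sum_cos α (2 * n)
    have h2 : ((2 * n : ℕ) : ℝ) * α - α / 2 = k * (2 * Real.pi) - α / 2 := by
      rw [hα]; push_cast; field_simp
    rw [h2, Real.sin_int_mul_two_pi_sub, neg_add_cancel] at h1
    refine (mul_eq_zero.1 h1).resolve_left ?_
    refine mul_ne_zero two_ne_zero ?_
    have hk1 : |(k : ℝ)| < 2 * n := by exact_mod_cast hk
    have hpi := Real.pi_pos
    have h3 : |α / 2| < Real.pi := by
      have : α / 2 = Real.pi * (k / (2 * n)) := by rw [hα]; field_simp
      rw [this, abs_mul, abs_of_pos hpi, abs_div, abs_of_pos (show (0 : ℝ) < 2 * n by positivity)]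
      have : |(k : ℝ)| / (2 * n) < 1 := by rw [div_lt_one (by positivity)]; exact hk1
      nlinarith
    have h4 : α / 2 ≠ 0 := by
      rw [hα]
      have : (k : ℝ) ≠ 0 := by exact_mod_cast h
      positivity
    obtain ⟨h5, h6⟩ := abs_lt.1 h3
    intro hs
    exact h4 ((Real.sin_eq_zero_iff_of_lt_of_lt h5 h6).1 hs)

lemma sum_sum_ite_sub_eq_of_nonneg {n k : ℕ} (hk : k ≤ n) :
    ∑ j : Fin n, ∑ l : Fin n, (if (j : ℤ) - l = k then (1 : ℝ) else 0) = n - k := by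
  rw [Finset.sum_comm]
  have h : ∀ l : Fin n, ∑ j : Fin n, (if (j : ℤ) - l = k then (1 : ℝ) else 0) =
      if (l : ℕ) < n - k then 1 else 0 := by
    intro l
    rw [Fin.sum_univ_eq_sum_range (fun j => if (j : ℤ) - l = k then (1 : ℝ) else 0)]
    have : ∀ j ∈ Finset.range n, (if (j : ℤ) - l = k then (1 : ℝ) else 0) =
        if l + k = j then 1 else 0 := fun j _ => if_congr (by omega) rfl rfl
    rw [Finset.sum_congr rfl this, Finset.sum_ite_eq]
    refine if_congr ?_ rfl rfl
    rw [Finset.mem_range]; omega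
  rw [Finset.sum_congr rfl fun l _ => h l,
    Fin.sum_univ_eq_sum_range (fun l => if l < n - k then (1 : ℝ) else 0), ← Finset.sum_filter]
  have : (Finset.range n).filter (fun l => l < n - k) = Finset.range (n - k) := by
    ext l; simp only [Finset.mem_filter, Finset.mem_range]; omega
  rw [this]
  simp [Nat.cast_sub hk]

lemma sum_sum_ite_sub_eq {n : ℕ} {k : ℤ} (hk : |k| ≤ n) :
    ∑ j : Fin n, ∑ l : Fin n, (if (j : ℤ) - l = k then (1 : ℝ) else 0) = n - |(k : ℝ)| := by
  obtain ⟨a, rfl | rfl⟩ := k.eq_nat_or_neg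
  · have := sum_sum_ite_sub_eq_of_nonneg (n := n) (k := a) (by simpa using hk)
    simpa using this
  · have := sum_sum_ite_sub_eq_of_nonneg (n := n) (k := a) (by simpa using hk)
    rw [Finset.sum_comm] at this
    rw [show n - |(((-(a : ℤ)) : ℤ) : ℝ)| = (n : ℝ) - a by simp, ← this]
    refine Finset.sum_congr rfl fun j _ => Finset.sum_congr rfl fun l _ => if_congr ?_ rfl rfl
    omega

/-- The spectral coefficients of a matrix at the equispaced frequencies. -/
def specCoeff {n : ℕ} (H : Matrix (Fin n) (Fin n) ℝ) (t : Fin (2 * n)) : ℝ :=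
  1 / (2 * (n : ℝ)) * ∑ j : Fin n, ∑ l : Fin n, H j l * Real.cos (freq n t * ((j : ℝ) - l))

lemma sum_cos_mul_cos_freq {n : ℕ} (hn : 1 ≤ n) (j l j' l' : Fin n) :
    ∑ t : Fin (2 * n), Real.cos (freq n t * ((j : ℝ) - l)) * Real.cos (freq n t * ((j' : ℝ) - l')) =
      n * ((if (j : ℤ) - l = (j' : ℤ) - l' then 1 else 0) +
        (if (j : ℤ) - l = (l' : ℤ) - j' then 1 else 0)) := by
  have h : ∀ t : Fin (2 * n),
      Real.cos (freq n t * ((j : ℝ) - l)) * Real.cos (freq n t * ((j' : ℝ) - l')) =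
      1 / 2 * (Real.cos (freq n t * (((j : ℤ) - l - (j' - l') : ℤ) : ℝ)) +
        Real.cos (freq n t * (((j : ℤ) - l - (l' - j') : ℤ) : ℝ))) := by
    intro t
    have e1 : freq n t * (((j : ℤ) - l - (j' - l') : ℤ) : ℝ) =
      freq n t * ((j : ℝ) - l) - freq n t * ((j' : ℝ) - l') := by push_cast; ring
    have e2 : freq n t * (((j : ℤ) - l - (l' - j') : ℤ) : ℝ) =
      freq n t * ((j : ℝ) - l) + freq n t * ((j' : ℝ) - l') := by push_cast; ring
    rw [e1, e2, Real.cos_sub, Real.cos_add]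
    ring
  have hj := j.2
  have hl := l.2
  have hj' := j'.2
  have hl' := l'.2
  rw [Finset.sum_congr rfl fun t _ => h t, ← Finset.mul_sum, Finset.sum_add_distrib,
    sum_cos_freq hn (by rw [abs_lt]; constructor <;> omega),
    sum_cos_freq hn (by rw [abs_lt]; constructor <;> omega)]
  simp only [sub_eq_zero]
  split_ifs <;> ring

lemma sum_specCoeff_mul_cos {n : ℕ} (hn : 1 ≤ n) {H : Matrix (Fin n) (Fin n) ℝ}
    (hT : ∀ i j k l : Fin n, i.1 + l.1 = k.1 + j.1 → H i j = H k l) (hS : H.IsSymm)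
    (j' l' : Fin n) :
    ∑ t, specCoeff H t * Real.cos (freq n t * ((j' : ℝ) - l')) =
      (n - |(j' : ℝ) - l'|) * H j' l' := by
  have hn0 : (0 : ℝ) < n := by exact_mod_cast hn
  have hj' := j'.2
  have hl' := l'.2
  have h1 : ∑ t, specCoeff H t * Real.cos (freq n t * ((j' : ℝ) - l')) =
      1 / (2 * (n : ℝ)) * ∑ j : Fin n, ∑ l : Fin n, H j l *
        ∑ t : Fin (2 * n), Real.cos (freq n t * ((j : ℝ) - l)) *
          Real.cos (freq n t * ((j' : ℝ) - l')) := by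
    simp only [specCoeff, Finset.mul_sum, Finset.sum_mul]
    rw [Finset.sum_comm]
    refine Finset.sum_congr rfl fun j _ => ?_
    rw [Finset.sum_comm]
    exact Finset.sum_congr rfl fun l _ => Finset.sum_congr rfl fun t _ => by ring
  have h2 : ∀ j l : Fin n, H j l *
        ∑ t : Fin (2 * n), Real.cos (freq n t * ((j : ℝ) - l)) *
          Real.cos (freq n t * ((j' : ℝ) - l')) =
      n * H j' l' * ((if (j : ℤ) - l = (j' : ℤ) - l' then 1 else 0) +
        (if (j : ℤ) - l = (l' : ℤ) - j' then 1 else 0)) := by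
    intro j l
    rw [sum_cos_mul_cos_freq hn]
    have a1 : (j : ℤ) - l = (j' : ℤ) - l' → H j l = H j' l' := fun h => hT j l j' l' (by omega)
    have a2 : (j : ℤ) - l = (l' : ℤ) - j' → H j l = H j' l' := fun h => by
      rw [hT j l l' j' (by omega), hS.apply]
    by_cases h : (j : ℤ) - l = (j' : ℤ) - l'
    · rw [a1 h]; ring
    · by_cases h' : (j : ℤ) - l = (l' : ℤ) - j'
      · rw [a2 h']; ring
      · simp [h, h']
  rw [h1, Finset.sum_congr rfl fun j _ => Finset.sum_congr rfl fun l _ => h2 j l]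
  simp only [← Finset.mul_sum, Finset.sum_add_distrib]
  rw [sum_sum_ite_sub_eq (by rw [abs_le]; constructor <;> omega),
    sum_sum_ite_sub_eq (by rw [abs_le]; constructor <;> omega)]
  push_cast
  rw [abs_sub_comm (l' : ℝ)]
  field_simp
  ring

lemma dotProduct_mulVec_eq_sum_specCoeff {n : ℕ} (hn : 2 ≤ n) {H : Matrix (Fin n) (Fin n) ℝ}
    (hT : ∀ i j k l : Fin n, i.1 + l.1 = k.1 + j.1 → H i j = H k l) (hS : H.IsSymm)
    (x : Fin n → ℝ) :
    x ⬝ᵥ H.mulVec x = ∑ t, specCoeff H t * freqForm (freq n t) x := by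
  set G : Fin n → Fin n → ℝ := fun j l => x j * x l * ((n - |(j : ℝ) - l|) * H j l) with hG
  have hGs : ∀ j l, G j l = G l j := by
    intro j l
    simp only [hG]
    rw [abs_sub_comm, hS.apply l j]; ring
  have h1 : ∑ t, specCoeff H t * freqForm (freq n t) x =
      ∑ j : Fin n, ∑ l : Fin n, G j l * freqKernel n j l := by
    simp only [freqForm_eq_sum, Finset.mul_sum]
    rw [Finset.sum_comm]
    refine Finset.sum_congr rfl fun j _ => ?_
    rw [Finset.sum_comm]
    refine Finset.sum_congr rfl fun l _ => ?_
    simp only [hG]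
    rw [← sum_specCoeff_mul_cos (by omega) hT hS, Finset.mul_sum, Finset.sum_mul]
    exact Finset.sum_congr rfl fun t _ => by ring
  have h2 : ∑ j : Fin n, ∑ l : Fin n, G j l * freqKernel n j l =
      ∑ j : Fin n, ∑ l : Fin n, G j l * freqKernel n l j := by
    rw [Finset.sum_comm]
    exact Finset.sum_congr rfl fun j _ => Finset.sum_congr rfl fun l _ => by rw [hGs]
  have h3 : ∑ j : Fin n, ∑ l : Fin n, G j l * freqKernel n j l +
      ∑ j : Fin n, ∑ l : Fin n, G j l * freqKernel n l j =
      ∑ j : Fin n, ∑ l : Fin n, 2 * (x j * x l * H j l) := by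
    simp only [← Finset.sum_add_distrib]
    refine Finset.sum_congr rfl fun j _ => Finset.sum_congr rfl fun l _ => ?_
    rw [← mul_add, freqKernel_add_swap hn]
    have : 0 < (n : ℝ) - |(j : ℝ) - l| := by
      rw [sub_pos, abs_lt]
      have a1 : (j : ℝ) < n := by exact_mod_cast j.2
      have a2 : (l : ℝ) < n := by exact_mod_cast l.2
      have a3 : (0 : ℝ) ≤ j := by positivity
      have a4 : (0 : ℝ) ≤ l := by positivity
      constructor <;> linarith
    simp only [hG]
    field_simp
  have h4 : x ⬝ᵥ H.mulVec x = ∑ j : Fin n, ∑ l : Fin n, x j * x l * H j l := by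
    simp only [dotProduct, mulVec, Finset.mul_sum]
    exact Finset.sum_congr rfl fun j _ => Finset.sum_congr rfl fun l _ => by ring
  simp only [← Finset.mul_sum] at h3
  rw [h1, h4]
  linarith

/-- The set of vectors whose modulated prefix and suffix sums have square-root growth. -/
def regularSet (n : ℕ) (ℓ : ℝ) : Set (Fin n → ℝ) :=
  {x | ∀ t : Fin (2 * n), ∀ q : Fin (n + 1),
    (|prefixSum (cosMod (freq n t) x) q| ≤ ℓ * √(q : ℕ) ∧
      |prefixSum (sinMod (freq n t) x) q| ≤ ℓ * √(q : ℕ)) ∧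
    |suffixSum (cosMod (freq n t) x) q| ≤ ℓ * √(q : ℕ) ∧
      |suffixSum (sinMod (freq n t) x) q| ≤ ℓ * √(q : ℕ)}

lemma measurable_prefixSum_cosMod {n : ℕ} (θ : ℝ) (q : ℕ) :
    Measurable fun x : Fin n → ℝ => prefixSum (cosMod θ x) q :=
  Finset.measurable_sum _ fun l _ => by unfold cosMod; split_ifs <;> fun_prop

lemma measurable_prefixSum_sinMod {n : ℕ} (θ : ℝ) (q : ℕ) :
    Measurable fun x : Fin n → ℝ => prefixSum (sinMod θ x) q :=
  Finset.measurable_sum _ fun l _ => by unfold sinMod; split_ifs <;> fun_prop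

lemma measurable_suffixSum_cosMod {n : ℕ} (θ : ℝ) (q : ℕ) :
    Measurable fun x : Fin n → ℝ => suffixSum (cosMod θ x) q :=
  Finset.measurable_sum _ fun l _ => by unfold cosMod; split_ifs <;> fun_prop

lemma measurable_suffixSum_sinMod {n : ℕ} (θ : ℝ) (q : ℕ) :
    Measurable fun x : Fin n → ℝ => suffixSum (sinMod θ x) q :=
  Finset.measurable_sum _ fun l _ => by unfold sinMod; split_ifs <;> fun_prop

lemma measurable_freqForm {n : ℕ} (θ : ℝ) : Measurable fun x : Fin n → ℝ => freqForm θ x := by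
  have h1 := measurable_prefixSum_cosMod (n := n) θ
  have h2 := measurable_prefixSum_sinMod (n := n) θ
  have h3 := measurable_suffixSum_cosMod (n := n) θ
  have h4 := measurable_suffixSum_sinMod (n := n) θ
  have h5 : ∀ p q, Measurable fun x : Fin n → ℝ => windowProd θ x p q := fun p q =>
    ((h3 p).mul (h1 q)).add ((h4 p).mul (h2 q))
  unfold freqForm
  refine ((h5 _ _).const_mul _).add (Measurable.add ?_ ?_)
  · exact Finset.measurable_sum _ fun D _ =>
      (Finset.measurable_sum _ fun p _ => h5 p (D - p)).const_mul _
  · exact (Finset.measurable_sum _ fun p _ => h5 p (n - p)).const_mul _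

lemma measurableSet_regularSet (n : ℕ) (ℓ : ℝ) : MeasurableSet (regularSet n ℓ) := by
  have h {f : (Fin n → ℝ) → ℝ} (hf : Measurable f) (c : ℝ) : MeasurableSet {x | |f x| ≤ c} :=
    measurableSet_le hf.abs measurable_const
  have e : regularSet n ℓ = ⋂ t : Fin (2 * n), ⋂ q : Fin (n + 1),
      ({x | |prefixSum (cosMod (freq n t) x) q| ≤ ℓ * √(q : ℕ)} ∩
        {x | |prefixSum (sinMod (freq n t) x) q| ≤ ℓ * √(q : ℕ)}) ∩
      ({x | |suffixSum (cosMod (freq n t) x) q| ≤ ℓ * √(q : ℕ)} ∩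
        {x | |suffixSum (sinMod (freq n t) x) q| ≤ ℓ * √(q : ℕ)}) := by
    ext x
    simp only [regularSet, Set.mem_iInter, Set.mem_inter_iff, Set.mem_ofPred_eq]
  rw [e]
  exact MeasurableSet.iInter fun t => MeasurableSet.iInter fun q =>
    ((h (measurable_prefixSum_cosMod _ _) _).inter (h (measurable_prefixSum_sinMod _ _) _)).inter
      ((h (measurable_suffixSum_cosMod _ _) _).inter (h (measurable_suffixSum_sinMod _ _) _))

lemma abs_freqForm_le_of_mem {n : ℕ} (hn : 2 ≤ n) {ℓ : ℝ} {x : Fin n → ℝ}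
    (hx : x ∈ regularSet n ℓ) (t : Fin (2 * n)) :
    |freqForm (freq n t) x| ≤ 17 * ℓ ^ 2 * Real.log n := by
  have h := fun q (hq : q ≤ n) => hx t ⟨q, by omega⟩
  exact abs_freqForm_le hn (fun q hq => (h q hq).1.1) (fun q hq => (h q hq).1.2)
    (fun q hq => (h q hq).2.1) (fun q hq => (h q hq).2.2)

lemma regularSet_compl_le {μ : Measure ℝ} (hμ : UnitMoments μ) {n : ℕ} (hn : 2 ≤ n) :
    (Measure.pi fun _ : Fin n => μ).real (regularSet n (1000 * Real.log n))ᶜ ≤ 1 / 20000 := by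
  have := hμ.prob
  set ℓ := 1000 * Real.log n with hℓ
  set c : Fin (2 * n) × Bool → Fin n → ℝ := fun κ l =>
    if κ.2 then Real.cos (freq n κ.1 * l) else Real.sin (freq n κ.1 * l) with hcdef
  have hc : ∀ κ l, |c κ l| ≤ 1 := by
    intro κ l
    simp only [hcdef]
    split_ifs
    · exact Real.abs_cos_le_one _
    · exact Real.abs_sin_le_one _
  have h1 := partialSum_tail hμ (Equiv.refl (Fin n)) hc ℓ
  have h2 := partialSum_tail hμ (Fin.revPerm (n := n)) hc ℓ
  have hsub : (regularSet n ℓ)ᶜ ⊆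
      {x | ∃ κ : Fin (2 * n) × Bool, ∃ p ∈ Finset.Icc 1 n, ℓ * √(p : ℝ) <
        |∑ l, if (Equiv.refl (Fin n) l : ℕ) < p then c κ l * x l else 0|} ∪
      {x | ∃ κ : Fin (2 * n) × Bool, ∃ p ∈ Finset.Icc 1 n, ℓ * √(p : ℝ) <
        |∑ l, if (Fin.revPerm (n := n) l : ℕ) < p then c κ l * x l else 0|} := by
    intro x hx
    by_contra hcon
    simp only [Set.mem_union, Set.mem_ofPred_eq, not_or, not_exists, not_and, not_lt] at hcon
    refine hx fun t q => ?_
    rcases Nat.eq_zero_or_pos (q : ℕ) with h0 | h0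
    · simp [h0, prefixSum, suffixSum]
    · have hq : (q : ℕ) ∈ Finset.Icc 1 n := Finset.mem_Icc.2 ⟨h0, by omega⟩
      exact ⟨⟨hcon.1 (t, true) q hq, hcon.1 (t, false) q hq⟩,
        ⟨hcon.2 (t, true) q hq, hcon.2 (t, false) q hq⟩⟩
  refine (measureReal_mono hsub (measure_ne_top _ _)).trans
    ((measureReal_union_le _ _).trans ((add_le_add h1 h2).trans ?_))
  have hn2 : (2 : ℝ) ≤ n := by exact_mod_cast hn
  have hlog : 2 / 3 ≤ Real.log n := by
    have : Real.log 2 ≤ Real.log n := Real.log_le_log (by norm_num) hn2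
    linarith [Real.log_two_gt_d9]
  have hn' : (n : ℝ) = Real.exp (Real.log n) := (Real.exp_log (by linarith)).symm
  have hcard : (Fintype.card (Fin (2 * n) × Bool) : ℝ) = 4 * n := by
    simp; ring
  have key : (n : ℝ) * n * Real.exp (1 - ℓ / 30) ≤ 1 / 2.5 ^ 19 := by
    rw [show (n : ℝ) * n * Real.exp (1 - ℓ / 30) =
        Real.exp (Real.log n + Real.log n + (1 - ℓ / 30)) by
      rw [Real.exp_add, Real.exp_add, ← hn']]
    calc _ ≤ Real.exp (-(19 : ℕ)) := by
          rw [Real.exp_le_exp, hℓ]; push_cast; linarith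
      _ = 1 / Real.exp 1 ^ 19 := by
          rw [Real.exp_neg, ← Real.exp_one_pow, one_div]
      _ ≤ _ := by
          gcongr
          linarith [Real.exp_one_gt_d9]
  rw [hcard]
  have : 2 * (4 * (n : ℝ)) * n * Real.exp (1 - ℓ / 30) ≤ 8 * (1 / 2.5 ^ 19) := by
    calc _ = 8 * ((n : ℝ) * n * Real.exp (1 - ℓ / 30)) := by ring
      _ ≤ _ := by gcongr
  norm_num at this ⊢
  linarith

lemma exists_spectral_decomposition {n : ℕ} {H : Matrix (Fin n) (Fin n) ℝ} (hH : H.IsHermitian) :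
    ∃ (v : Fin n → Fin n → ℝ) (ev : Fin n → ℝ),
      (∀ i j, H i j = ∑ s, ev s * (v s i * v s j)) ∧
      ∀ s s', v s ⬝ᵥ v s' = if s = s' then 1 else 0 := by
  refine ⟨fun s i => (hH.eigenvectorUnitary : Matrix (Fin n) (Fin n) ℝ) i s, hH.eigenvalues, ?_, ?_⟩
  · intro i j
    have h := hH.spectral_theorem
    rw [Unitary.conjStarAlgAut_apply] at h
    conv_lhs => rw [h]
    rw [Matrix.mul_apply]
    refine Finset.sum_congr rfl fun s _ => ?_
    rw [Matrix.mul_diagonal]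
    simp [Matrix.star_apply]
    ring
  · intro s s'
    have h : star (hH.eigenvectorUnitary : Matrix (Fin n) (Fin n) ℝ) *
        (hH.eigenvectorUnitary : Matrix (Fin n) (Fin n) ℝ) = 1 :=
      Unitary.coe_star_mul_self hH.eigenvectorUnitary
    have h2 := congrFun (congrFun h s) s'
    rw [Matrix.mul_apply, Matrix.one_apply] at h2
    simpa [Matrix.star_apply, dotProduct] using h2

section decomposition

variable {n : ℕ} {H : Matrix (Fin n) (Fin n) ℝ} {v : Fin n → Fin n → ℝ} {ev : Fin n → ℝ}

lemma mulVec_of_decomposition (hH : ∀ i j, H i j = ∑ s, ev s * (v s i * v s j)) (x : Fin n → ℝ) :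
    H.mulVec x = ∑ s, (ev s * (v s ⬝ᵥ x)) • v s := by
  ext i
  simp only [mulVec, dotProduct, hH, Finset.sum_apply, Pi.smul_apply, smul_eq_mul, Finset.sum_mul,
    Finset.mul_sum]
  rw [Finset.sum_comm]
  exact Finset.sum_congr rfl fun s _ => Finset.sum_congr rfl fun j _ => by ring

lemma trace_of_decomposition (hH : ∀ i j, H i j = ∑ s, ev s * (v s i * v s j))
    (hv : ∀ s s', v s ⬝ᵥ v s' = if s = s' then 1 else 0) : H.trace = ∑ s, ev s := by
  simp only [trace, diag_apply, hH]
  rw [Finset.sum_comm]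
  refine Finset.sum_congr rfl fun s _ => ?_
  have := hv s s
  simp only [dotProduct, if_true] at this
  rw [← Finset.mul_sum, this, mul_one]

lemma sum_sq_of_decomposition (hH : ∀ i j, H i j = ∑ s, ev s * (v s i * v s j))
    (hv : ∀ s s', v s ⬝ᵥ v s' = if s = s' then 1 else 0) :
    ∑ i, ∑ j, H i j ^ 2 = ∑ s, ev s ^ 2 := by
  have h1 : ∀ i j, H i j ^ 2 = ∑ s, ev s * (v s i * (H i j * v s j)) := by
    intro i j
    rw [sq]
    nth_rewrite 2 [hH i j]
    rw [Finset.mul_sum]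
    exact Finset.sum_congr rfl fun s _ => by ring
  have h2 : ∀ i s, ∑ j, H i j * v s j = ev s * v s i := by
    intro i s
    have := congrFun (mulVec_of_decomposition hH (v s)) i
    simp only [mulVec, dotProduct] at this
    rw [this, Finset.sum_apply, Finset.sum_eq_single s]
    · have := hv s s
      simp only [dotProduct, if_true] at this
      simp [this]
    · intro s' _ hne
      have := hv s' s
      simp only [dotProduct, if_neg hne] at this
      simp [this]
    · simp
  have h3 : ∑ i, ∑ j, H i j ^ 2 = ∑ s, ∑ i, ev s * (v s i * ∑ j, H i j * v s j) := by
    simp only [h1, Finset.mul_sum]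
    rw [Finset.sum_comm (s := (Finset.univ : Finset (Fin n))) (t := (Finset.univ : Finset (Fin n)))
      (f := fun s i => ∑ j, ev s * (v s i * (H i j * v s j)))]
    exact Finset.sum_congr rfl fun i _ => Finset.sum_comm
  rw [h3]
  refine Finset.sum_congr rfl fun s _ => ?_
  have := hv s s
  simp only [dotProduct, if_true] at this
  simp only [h2]
  calc ∑ i, ev s * (v s i * (ev s * v s i)) = ev s ^ 2 * ∑ i, v s i * v s i := by
        rw [Finset.mul_sum]; exact Finset.sum_congr rfl fun i _ => by ring
    _ = _ := by rw [this, mul_one]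

lemma card_neg_le_rank (hH : ∀ i j, H i j = ∑ s, ev s * (v s i * v s j))
    (hv : ∀ s s', v s ⬝ᵥ v s' = if s = s' then 1 else 0) {S : Matrix (Fin n) (Fin n) ℝ}
    (hpos : ∀ x : Fin n → ℝ, S.mulVec x = 0 → 0 ≤ x ⬝ᵥ H.mulVec x) :
    (Finset.univ.filter fun s => ev s < 0).card ≤ S.rank := by
  have hli : LinearIndependent ℝ
      (fun s : {s // ev s < 0} => S.mulVec (v s)) := by
    rw [Fintype.linearIndependent_iff]
    intro g hg
    set x : Fin n → ℝ := ∑ s : {s // ev s < 0}, g s • v s with hx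
    have hSx : S.mulVec x = 0 := by
      rw [hx, Matrix.mulVec_sum, ← hg]
      exact Finset.sum_congr rfl fun s _ => by rw [mulVec_smul]
    have hvx : ∀ s : Fin n, v s ⬝ᵥ x = if h : ev s < 0 then g ⟨s, h⟩ else 0 := by
      intro s
      rw [hx, dotProduct_sum]
      simp only [dotProduct_smul, hv, smul_eq_mul, mul_ite, mul_one, mul_zero]
      split_ifs with h
      · rw [Finset.sum_eq_single ⟨s, h⟩]
        · simp
        · intro b _ hb
          rw [if_neg]
          intro h'
          exact hb (Subtype.ext h'.symm)
        · simp
      · refine Finset.sum_eq_zero fun b _ => if_neg ?_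
        intro h'
        exact h (h' ▸ b.2)
    have h0 := hpos x hSx
    rw [mulVec_of_decomposition hH, dotProduct_sum] at h0
    have hterm : ∀ s, x ⬝ᵥ ((ev s * (v s ⬝ᵥ x)) • v s) = ev s * (v s ⬝ᵥ x) ^ 2 := by
      intro s
      rw [dotProduct_smul, dotProduct_comm x, smul_eq_mul]; ring
    simp only [hterm] at h0
    have hle : ∀ s ∈ Finset.univ, ev s * (v s ⬝ᵥ x) ^ 2 ≤ 0 := by
      intro s _
      rw [hvx]
      split_ifs with h
      · nlinarith [sq_nonneg (g ⟨s, h⟩)]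
      · simp
    have hz := (Finset.sum_eq_zero_iff_of_nonpos hle).1 (le_antisymm (Finset.sum_nonpos hle) h0)
    intro s
    have := hz s (Finset.mem_univ _)
    rw [hvx, dif_pos s.2] at this
    rcases mul_eq_zero.1 this with h | h
    · exact absurd h s.2.ne
    · exact pow_eq_zero_iff (two_ne_zero) |>.1 h
  have h1 := finrank_span_eq_card hli
  rw [Fintype.card_subtype] at h1
  rw [← h1]
  refine Submodule.finrank_mono ?_
  rw [Submodule.span_le]
  rintro _ ⟨s, rfl⟩
  exact ⟨v s, rfl⟩

lemma sum_abs_le_of_trace_nonpos (hH : ∀ i j, H i j = ∑ s, ev s * (v s i * v s j))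
    (hv : ∀ s s', v s ⬝ᵥ v s' = if s = s' then 1 else 0) (htr : H.trace ≤ 0) {r : ℕ}
    (hr : (Finset.univ.filter fun s => ev s < 0).card ≤ r) :
    ∑ s, |ev s| ≤ 2 * √r * √(∑ i, ∑ j, H i j ^ 2) := by
  rw [trace_of_decomposition hH hv] at htr
  rw [sum_sq_of_decomposition hH hv]
  set N := Finset.univ.filter fun s => ev s < 0 with hN
  have h1 : ∑ s, |ev s| = ∑ s, ev s + 2 * ∑ s ∈ N, |ev s| := by
    rw [hN, Finset.sum_filter, Finset.mul_sum, ← Finset.sum_add_distrib]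
    refine Finset.sum_congr rfl fun s _ => ?_
    split_ifs with h
    · rw [abs_of_neg h]; ring
    · rw [abs_of_nonneg (not_lt.1 h)]; ring
  have h2 : ∑ s ∈ N, |ev s| ≤ √r * √(∑ s, ev s ^ 2) := by
    rw [← Real.sqrt_mul (by positivity)]
    refine Real.le_sqrt_of_sq_le ?_
    refine sq_sum_le_card_mul_sum_sq.trans ?_
    simp only [sq_abs]
    gcongr
    exact Finset.subset_univ _
  linarith

lemma specCoeff_of_decomposition (hH : ∀ i j, H i j = ∑ s, ev s * (v s i * v s j))
    (t : Fin (2 * n)) :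
    specCoeff H t = ∑ s, ev s * specCoeff (Matrix.vecMulVec (v s) (v s)) t := by
  simp only [specCoeff, vecMulVec_apply, hH, Finset.mul_sum, Finset.sum_mul]
  symm
  rw [Finset.sum_comm]
  refine Finset.sum_congr rfl fun j _ => ?_
  rw [Finset.sum_comm]
  exact Finset.sum_congr rfl fun s _ => Finset.sum_congr rfl fun l _ => by ring

end decomposition

lemma specCoeff_vecMulVec_nonneg {n : ℕ} (x : Fin n → ℝ) (t : Fin (2 * n)) :
    0 ≤ specCoeff (Matrix.vecMulVec x x) t := by
  have : ∑ j : Fin n, ∑ l : Fin n, Matrix.vecMulVec x x j l *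
      Real.cos (freq n t * ((j : ℝ) - l)) =
      (∑ j, cosMod (freq n t) x j) ^ 2 + (∑ j, sinMod (freq n t) x j) ^ 2 := by
    simp only [sq, Finset.sum_mul_sum, ← Finset.sum_add_distrib, cosMod_mul_add_sinMod_mul,
      vecMulVec_apply]
  unfold specCoeff
  rw [this]
  positivity

lemma sum_specCoeff {n : ℕ} (hn : 1 ≤ n) (H : Matrix (Fin n) (Fin n) ℝ) :
    ∑ t, specCoeff H t = H.trace := by
  have hn0 : (0 : ℝ) < n := by exact_mod_cast hn
  simp only [specCoeff, ← Finset.mul_sum]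
  rw [Finset.sum_comm]
  have h : ∀ j : Fin n, ∑ t : Fin (2 * n), ∑ l : Fin n,
      H j l * Real.cos (freq n t * ((j : ℝ) - l)) = 2 * n * H j j := by
    intro j
    rw [Finset.sum_comm]
    have h1 : ∀ l : Fin n, ∑ t : Fin (2 * n), H j l * Real.cos (freq n t * ((j : ℝ) - l)) =
        if j = l then 2 * n * H j j else 0 := by
      intro l
      have hj := j.2
      have hl := l.2
      have := sum_cos_freq hn (k := (j : ℤ) - l) (by rw [abs_lt]; constructor <;> omega)
      push_cast at this
      rw [← Finset.mul_sum, this]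
      by_cases h : j = l
      · subst h; simp; ring
      · rw [if_neg h, if_neg, mul_zero]
        intro h'
        exact h (Fin.ext (by omega))
    simp [h1]
  rw [Finset.sum_congr rfl fun j _ => h j, ← Finset.mul_sum]
  simp only [trace, diag_apply]
  field_simp

lemma sum_abs_specCoeff_le {n : ℕ} (hn : 1 ≤ n) {H S : Matrix (Fin n) (Fin n) ℝ}
    (hH : H.IsHermitian) (htr : H.trace ≤ 0) {r : ℕ} (hr : S.rank ≤ r)
    (hpos : ∀ x : Fin n → ℝ, S.mulVec x = 0 → 0 ≤ x ⬝ᵥ H.mulVec x) :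
    ∑ t, |specCoeff H t| ≤ 2 * √r * √(∑ i, ∑ j, H i j ^ 2) := by
  obtain ⟨v, ev, hd, hv⟩ := exists_spectral_decomposition hH
  refine le_trans ?_ (sum_abs_le_of_trace_nonpos hd hv htr ((card_neg_le_rank hd hv hpos).trans hr))
  calc ∑ t, |specCoeff H t|
      ≤ ∑ t, ∑ s, |ev s| * specCoeff (Matrix.vecMulVec (v s) (v s)) t := by
        refine Finset.sum_le_sum fun t _ => ?_
        rw [specCoeff_of_decomposition hd]
        refine (Finset.abs_sum_le_sum_abs _ _).trans (le_of_eq ?_)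
        exact Finset.sum_congr rfl fun s _ => by
          rw [abs_mul, abs_of_nonneg (specCoeff_vecMulVec_nonneg _ _)]
    _ = ∑ s, |ev s| := by
        rw [Finset.sum_comm]
        refine Finset.sum_congr rfl fun s _ => ?_
        rw [← Finset.mul_sum, sum_specCoeff hn, Matrix.trace_vecMulVec, hv]
        simp

lemma sum_mul_add_sub_mean_sq_le {X : Type*} [Fintype X] {w : X → ℝ} (hw : ∀ x, 0 ≤ w x)
    (hsum : ∑ x, w x = 1) {g : X → ℝ} {L : ℝ} (hg : ∀ x, |g x| ≤ L) (e : ℝ) :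
    ∑ x, w x * (e + (g x - ∑ y, w y * g y)) ^ 2 ≤ e ^ 2 + L ^ 2 := by
  set f := ∑ y, w y * g y with hf
  have h1 : ∑ x, w x * (e + (g x - f)) ^ 2 =
      (e - f) ^ 2 * ∑ x, w x + 2 * (e - f) * ∑ x, w x * g x + ∑ x, w x * g x ^ 2 := by
    simp only [Finset.mul_sum, ← Finset.sum_add_distrib]
    exact Finset.sum_congr rfl fun x _ => by ring
  have h2 : ∑ x, w x * g x ^ 2 ≤ ∑ x, w x * L ^ 2 :=
    Finset.sum_le_sum fun x _ => mul_le_mul_of_nonneg_left (sq_le_sq' (abs_le.1 (hg x)).1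
      (abs_le.1 (hg x)).2) (hw x)
  rw [← Finset.sum_mul, hsum, one_mul] at h2
  rw [h1, hsum, ← hf]
  nlinarith [sq_nonneg f]

/-- Maurey's empirical approximation of a convex combination, in `L²` of a finite measure. -/
lemma exists_empirical_approximation {X E : Type*} [Fintype X] [MeasurableSpace E] (ν : Measure E)
    [IsFiniteMeasure ν] {w : X → ℝ} (hw : ∀ x, 0 ≤ w x) (hsum : ∑ x, w x = 1) {g : X → E → ℝ}
    (hgm : ∀ x, Measurable (g x)) {L : ℝ} (hg : ∀ x e, |g x e| ≤ L) (N : ℕ) :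
    ∃ κ : Fin N → X, ∫ e, (∑ l, g (κ l) e - N * ∑ x, w x * g x e) ^ 2 ∂ν ≤
      N * L ^ 2 * ν.real Set.univ := by
  have hne : Nonempty X := by
    by_contra h
    rw [not_nonempty_iff] at h
    simp at hsum
  set f : E → ℝ := fun e => ∑ x, w x * g x e with hf
  have hfm : Measurable f := Finset.measurable_sum _ fun x _ => (hgm x).const_mul _
  have hfb : ∀ e, |f e| ≤ L := by
    intro e
    calc |f e| ≤ ∑ x, |w x * g x e| := Finset.abs_sum_le_sum_abs _ _
      _ ≤ ∑ x, w x * L := Finset.sum_le_sum fun x _ => by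
          rw [abs_mul, abs_of_nonneg (hw x)]; exact mul_le_mul_of_nonneg_left (hg x e) (hw x)
      _ = L := by rw [← Finset.sum_mul, hsum, one_mul]
  have hintg : ∀ {h : E → ℝ} (_ : Measurable h) (B : ℝ) (_ : ∀ e, |h e| ≤ B),
      Integrable (fun e => h e ^ 2) ν := by
    intro h hm B hB
    refine Integrable.mono' (integrable_const (B ^ 2)) (by fun_prop)
      (Filter.Eventually.of_forall fun e => ?_)
    rw [Real.norm_eq_abs, abs_pow]
    exact pow_le_pow_left₀ (abs_nonneg _) (hB e) 2
  induction N with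
  | zero => exact ⟨Fin.elim0, by simp⟩
  | succ N ih =>
    obtain ⟨κ, hκ⟩ := ih
    set err : E → ℝ := fun e => ∑ l, g (κ l) e - N * f e with herr
    have herrm : Measurable err :=
      (Finset.measurable_sum _ fun l _ => hgm (κ l)).sub (hfm.const_mul _)
    have herrb : ∀ e, |err e| ≤ N * L + N * L := by
      intro e
      refine (abs_sub _ _).trans (add_le_add ?_ ?_)
      · refine (Finset.abs_sum_le_sum_abs _ _).trans ?_
        refine (Finset.sum_le_sum fun l _ => hg (κ l) e).trans (by simp)
      · rw [abs_mul, Nat.abs_cast]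
        exact mul_le_mul_of_nonneg_left (hfb e) (by positivity)
    have hi : ∀ y, Integrable (fun e => (err e + (g y e - f e)) ^ 2) ν := fun y =>
      hintg (h := fun e => err e + (g y e - f e)) (herrm.add ((hgm y).sub hfm))
        (N * L + N * L + (L + L)) fun e => (abs_add_le _ _).trans
          (add_le_add (herrb e) ((abs_sub _ _).trans (add_le_add (hg y e) (hfb e))))
    obtain ⟨y, hy⟩ := Finite.exists_min fun y => ∫ e, (err e + (g y e - f e)) ^ 2 ∂ν
    refine ⟨Fin.cons y κ, ?_⟩
    have e1 : ∀ e, ∑ l, g ((Fin.cons y κ : Fin (N + 1) → X) l) e - ((N + 1 : ℕ) : ℝ) * f e =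
        err e + (g y e - f e) := by
      intro e
      rw [Fin.sum_univ_succ]
      simp only [Fin.cons_zero, Fin.cons_succ, herr]
      push_cast; ring
    refine le_trans (le_of_eq (integral_congr_ae
      (Filter.Eventually.of_forall fun e => congrArg (· ^ 2) (e1 e)))) ?_
    calc ∫ e, (err e + (g y e - f e)) ^ 2 ∂ν
        = ∑ x, w x * ∫ e, (err e + (g y e - f e)) ^ 2 ∂ν := by
          rw [← Finset.sum_mul, hsum, one_mul]
      _ ≤ ∑ x, w x * ∫ e, (err e + (g x e - f e)) ^ 2 ∂ν :=
          Finset.sum_le_sum fun x _ => mul_le_mul_of_nonneg_left (hy x) (hw x)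
      _ = ∫ e, ∑ x, w x * (err e + (g x e - f e)) ^ 2 ∂ν := by
          rw [integral_finsetSum _ fun x _ => (hi x).const_mul _]
          exact Finset.sum_congr rfl fun x _ => (integral_const_mul _ _).symm
      _ ≤ ∫ e, (err e ^ 2 + L ^ 2) ∂ν :=
          integral_mono (integrable_finsetSum _ fun x _ => (hi x).const_mul _)
            ((hintg herrm _ herrb).add (integrable_const _))
            fun e => sum_mul_add_sub_mean_sq_le hw hsum (fun x => hg x e) (err e)
      _ = ∫ e, err e ^ 2 ∂ν + L ^ 2 * ν.real Set.univ := by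
          rw [integral_add (hintg herrm _ herrb) (integrable_const _)]
          simp [mul_comm]
      _ ≤ _ := by
          push_cast
          linarith

lemma map_uncurry_pi_pi {ι κ : Type*} [Fintype ι] [Fintype κ] (μ : Measure ℝ)
    [IsProbabilityMeasure μ] :
    (Measure.pi fun _ : ι => Measure.pi fun _ : κ => μ).map
      (fun (A : ι → κ → ℝ) (p : ι × κ) => A p.1 p.2) = Measure.pi fun _ : ι × κ => μ := by
  refine (Measure.pi_eq fun s hs => ?_).symm
  rw [Measure.map_apply (by fun_prop) (MeasurableSet.univ_pi hs)]
  have : (fun (A : ι → κ → ℝ) (p : ι × κ) => A p.1 p.2) ⁻¹' Set.univ.pi s =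
      Set.univ.pi fun i => Set.univ.pi fun j => s (i, j) := by
    ext A
    simp
  rw [this, Measure.pi_pi]
  simp only [Measure.pi_pi]
  rw [Fintype.prod_prod_type]

lemma map_eq_pi_pi_of_iIndepFun {Ω ι κ : Type*} [MeasurableSpace Ω] {P : Measure Ω}
    [Fintype ι] [Fintype κ] {μ : Measure ℝ} [IsProbabilityMeasure μ] {a : ι → Ω → κ → ℝ}
    (hm : ∀ i j, Measurable fun ω => a i ω j)
    (hind : iIndepFun (fun (p : ι × κ) ω => a p.1 ω p.2) P)
    (hlaw : ∀ i j, P.map (fun ω => a i ω j) = μ) :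
    P.map (fun ω i => a i ω) = Measure.pi fun _ : ι => Measure.pi fun _ : κ => μ := by
  have h1 := hind.map_fun_eq_pi_map fun p : ι × κ => (hm p.1 p.2).aemeasurable
  simp only [hlaw] at h1
  rw [← map_uncurry_pi_pi] at h1
  have h2 := congrArg (Measure.map fun (B : ι × κ → ℝ) i j => B (i, j)) h1
  rw [Measure.map_map (by fun_prop) (by fun_prop),
    Measure.map_map (by fun_prop) (by fun_prop)] at h2
  exact h2.trans Measure.map_id

lemma integral_exp_neg_indicator_le {E : Type*} [MeasurableSpace E] {ρ : Measure E}
    [IsProbabilityMeasure ρ] {U : Set E} (hU : MeasurableSet U) {q : ℝ} (hq : q ≤ ρ.real U) :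
    ∫ x, Real.exp (-U.indicator (fun _ => (1 : ℝ)) x) ∂ρ ≤ Real.exp (-(q / 2)) := by
  have h1 : ∀ x, Real.exp (-U.indicator (fun _ => (1 : ℝ)) x) ≤
      1 - 1 / 2 * U.indicator (fun _ => (1 : ℝ)) x := by
    intro x
    by_cases hx : x ∈ U
    · simp only [Set.indicator_of_mem hx]
      rw [Real.exp_neg, inv_le_comm₀ (Real.exp_pos _) (by norm_num)]
      linarith [Real.exp_one_gt_d9]
    · simp [Set.indicator_of_notMem hx]
  have hi : Integrable (U.indicator fun _ => (1 : ℝ)) ρ := (integrable_const _).indicator hU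
  have hm : Measurable (U.indicator fun _ => (1 : ℝ)) := measurable_const.indicator hU
  calc _ ≤ ∫ x, (1 - 1 / 2 * U.indicator (fun _ => (1 : ℝ)) x) ∂ρ := by
        refine integral_mono_of_nonneg (Filter.Eventually.of_forall fun x => (Real.exp_pos _).le)
          ((integrable_const _).sub (hi.const_mul _)) (Filter.Eventually.of_forall h1)
    _ = 1 - 1 / 2 * ρ.real U := by
        rw [integral_sub (integrable_const _) (hi.const_mul _), integral_const_mul,
          integral_indicator hU]
        simp
    _ ≤ 1 - q / 2 := by linarith
    _ ≤ _ := by linarith [Real.add_one_le_exp (-(q / 2))]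

lemma count_le_tail {E : Type*} [MeasurableSpace E] {ρ : Measure E} [IsProbabilityMeasure ρ]
    {U : Set E} (hU : MeasurableSet U) {q : ℝ} (hq : q ≤ ρ.real U) (m : ℕ) :
    (Measure.pi fun _ : Fin m => ρ).real
      {A | ∑ i, U.indicator (fun _ => (1 : ℝ)) (A i) ≤ q / 4 * m} ≤ Real.exp (-(q / 4 * m)) := by
  have hm : Measurable (U.indicator fun _ => (1 : ℝ)) := measurable_const.indicator hU
  have hexp : ∀ A : Fin m → E, Real.exp (-1 * ∑ i, U.indicator (fun _ => (1 : ℝ)) (A i)) =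
      ∏ i, Real.exp (-U.indicator (fun _ => (1 : ℝ)) (A i)) := by
    intro A
    rw [← Real.exp_sum]
    simp
  have hb : Integrable (fun x => Real.exp (-U.indicator (fun _ => (1 : ℝ)) x)) ρ := by
    refine Integrable.mono' (integrable_const 1) (by fun_prop)
      (Filter.Eventually.of_forall fun x => ?_)
    rw [Real.norm_eq_abs, Real.abs_exp, Real.exp_le_one_iff, neg_nonpos]
    exact Set.indicator_nonneg (fun _ _ => zero_le_one) x
  have hintg : Integrable (fun A : Fin m → E => ∏ i, Real.exp (-U.indicator (fun _ => (1 : ℝ)) (A i)))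
      (Measure.pi fun _ => ρ) :=
    Integrable.fintype_prod (f := fun _ x => Real.exp (-U.indicator (fun _ => (1 : ℝ)) x))
      fun _ => hb
  have h := measure_le_le_exp_mul_mgf (μ := Measure.pi fun _ : Fin m => ρ)
    (X := fun A => ∑ i, U.indicator (fun _ => (1 : ℝ)) (A i)) (t := -1) (q / 4 * m) (by norm_num)
    (by simpa only [hexp] using hintg)
  refine h.trans ?_
  simp only [mgf, hexp]
  rw [integral_fintype_prod_eq_prod (μ := fun _ => ρ)
    (fun _ x => Real.exp (-U.indicator (fun _ => (1 : ℝ)) x))]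
  rw [Finset.prod_const, Finset.card_univ, Fintype.card_fin]
  calc _ ≤ Real.exp (- -1 * (q / 4 * m)) * Real.exp (-(q / 2)) ^ m := by
        gcongr
        exact integral_exp_neg_indicator_le hU hq
    _ = _ := by
        rw [← Real.exp_nat_mul, ← Real.exp_add]
        congr 1
        ring

/-- The set where a sum of `N` dictionary elements is large. -/
def largeSet {X E : Type*} (g : X → E → ℝ) (τ : ℝ) {N : ℕ} (κ : Fin N → X) : Set E :=
  {x | N * τ / 2 ≤ |∑ l, g (κ l) x|}

lemma measurableSet_largeSet {X E : Type*} [MeasurableSpace E] {g : X → E → ℝ}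
    (hg : ∀ x, Measurable (g x)) (τ : ℝ) {N : ℕ} (κ : Fin N → X) :
    MeasurableSet (largeSet g τ κ) :=
  measurableSet_le measurable_const (Finset.measurable_sum _ fun l _ => hg (κ l)).abs

/-- Samples hitting every likely large set a proportional number of times. -/
def wellSampled {X E : Type*} [MeasurableSpace E] (ρ : Measure E) (g : X → E → ℝ) (τ p : ℝ)
    (N m : ℕ) : Set (Fin m → E) :=
  {A | ∀ κ : Fin N → X, p / 4 ≤ ρ.real (largeSet g τ κ) →
    p / 16 * m < ∑ i, (largeSet g τ κ).indicator (fun _ => (1 : ℝ)) (A i)}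

lemma wellSampled_compl_le {X E : Type*} [Fintype X] [MeasurableSpace E] {ρ : Measure E}
    [IsProbabilityMeasure ρ] {g : X → E → ℝ} (hg : ∀ x, Measurable (g x)) (τ p : ℝ) (N m : ℕ) :
    (Measure.pi fun _ : Fin m => ρ).real (wellSampled ρ g τ p N m)ᶜ ≤
      (Fintype.card X : ℝ) ^ N * Real.exp (-(p / 16 * m)) := by
  set B : (Fin N → X) → Set (Fin m → E) := fun κ =>
    {A | p / 4 ≤ ρ.real (largeSet g τ κ) ∧
      ∑ i, (largeSet g τ κ).indicator (fun _ => (1 : ℝ)) (A i) ≤ p / 16 * m} with hB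
  have hsub : (wellSampled ρ g τ p N m)ᶜ ⊆ ⋃ κ, B κ := by
    intro A hA
    simp only [wellSampled, Set.mem_compl_iff, Set.mem_ofPred_eq, not_forall, not_lt] at hA
    obtain ⟨κ, h1, h2⟩ := hA
    exact Set.mem_iUnion.2 ⟨κ, h1, h2⟩
  classical
  refine (measureReal_mono hsub (measure_ne_top _ _)).trans
    ((measureReal_iUnion_fintype_le _).trans ?_)
  calc _ ≤ ∑ _κ : Fin N → X, Real.exp (-(p / 16 * m)) := by
        refine Finset.sum_le_sum fun κ _ => ?_
        by_cases h : p / 4 ≤ ρ.real (largeSet g τ κ)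
        · have := count_le_tail (measurableSet_largeSet hg τ κ) h m
          have e : p / 4 / 4 = p / 16 := by ring
          rw [e] at this
          simpa only [hB, h, true_and] using this
        · simp only [hB, h, false_and]
          simpa using (Real.exp_pos _).le
    _ = _ := by simp

lemma measurableSet_wellSampled {X E : Type*} [Finite X] [MeasurableSpace E] {ρ : Measure E}
    {g : X → E → ℝ} (hg : ∀ x, Measurable (g x)) (τ p : ℝ) (N m : ℕ) :
    MeasurableSet (wellSampled ρ g τ p N m) := by
  have e : wellSampled ρ g τ p N m = ⋂ κ : Fin N → X, ⋂ _ : p / 4 ≤ ρ.real (largeSet g τ κ),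
      {A | p / 16 * m < ∑ i, (largeSet g τ κ).indicator (fun _ => (1 : ℝ)) (A i)} := by
    ext A
    simp only [wellSampled, Set.mem_iInter, Set.mem_ofPred_eq]
  rw [e]
  refine MeasurableSet.iInter fun κ => MeasurableSet.iInter fun _ => ?_
  have hm : Measurable ((largeSet g τ κ).indicator fun _ => (1 : ℝ)) :=
    measurable_const.indicator (measurableSet_largeSet hg τ κ)
  exact measurableSet_lt measurable_const
    (Finset.measurable_sum _ fun i _ => hm.comp (measurable_pi_apply i))

lemma le_sum_sq_of_wellSampled {X E : Type*} [Fintype X] [MeasurableSpace E] {ρ : Measure E}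
    [IsProbabilityMeasure ρ] {g : X → E → ℝ} (hgm : ∀ x, Measurable (g x)) {L τ p : ℝ}
    (hg : ∀ x e, |g x e| ≤ L) (hτ : 0 < τ) {N m : ℕ} (hN : 0 < N) (hm : 0 < m)
    (hNL : 1024 * L ^ 2 ≤ N * p * τ ^ 2) {A : Fin m → E} (hA : A ∈ wellSampled ρ g τ p N m)
    {w : X → ℝ} (hw : ∀ x, 0 ≤ w x) (hsum : ∑ x, w x = 1)
    (hD : p / 2 ≤ ρ.real {e | τ ≤ |∑ x, w x * g x e|}) :
    m * (p * τ ^ 2 / 512) ≤ ∑ i, (∑ x, w x * g x (A i)) ^ 2 := by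
  have hm0 : (0 : ℝ) < m := by exact_mod_cast hm
  have hN0 : (0 : ℝ) < N := by exact_mod_cast hN
  set D : E → ℝ := fun e => ∑ x, w x * g x e with hDdef
  have hDm : Measurable D := Finset.measurable_sum _ fun x _ => (hgm x).const_mul _
  have hDb : ∀ e, |D e| ≤ L := by
    intro e
    calc |D e| ≤ ∑ x, |w x * g x e| := Finset.abs_sum_le_sum_abs _ _
      _ ≤ ∑ x, w x * L := Finset.sum_le_sum fun x _ => by
          rw [abs_mul, abs_of_nonneg (hw x)]; exact mul_le_mul_of_nonneg_left (hg x e) (hw x)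
      _ = L := by rw [← Finset.sum_mul, hsum, one_mul]
  set ν : Measure E := ρ + ENNReal.ofReal (1 / m) • ∑ i, Measure.dirac (A i) with hν
  have hfinsum : IsFiniteMeasure (∑ i, Measure.dirac (A i)) := ⟨by simp⟩
  have hfinemp : IsFiniteMeasure (ENNReal.ofReal (1 / m) • ∑ i, Measure.dirac (A i)) :=
    Measure.smul_finite _ ENNReal.ofReal_ne_top
  have hfin : IsFiniteMeasure ν := by rw [hν]; infer_instance
  obtain ⟨κ, hκ⟩ := exists_empirical_approximation ν hw hsum hgm hg N
  set err : E → ℝ := fun e => ∑ l, g (κ l) e - N * D e with herr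
  have herrm : Measurable err :=
    (Finset.measurable_sum _ fun l _ => hgm (κ l)).sub (hDm.const_mul _)
  have hb : ∀ e, |err e ^ 2| ≤ (N * L + N * L) ^ 2 := by
    intro e
    rw [abs_pow]
    refine pow_le_pow_left₀ (abs_nonneg _) ?_ 2
    refine (abs_sub _ _).trans (add_le_add ?_ ?_)
    · refine (Finset.abs_sum_le_sum_abs _ _).trans ?_
      refine (Finset.sum_le_sum fun l _ => hg (κ l) e).trans (by simp)
    · rw [abs_mul, Nat.abs_cast]
      exact mul_le_mul_of_nonneg_left (hDb e) (by positivity)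
  have hintg : ∀ (ν' : Measure E) [IsFiniteMeasure ν'], Integrable (fun e => err e ^ 2) ν' :=
    fun ν' _ => Integrable.mono' (integrable_const ((N * L + N * L) ^ 2)) (by fun_prop)
      (Filter.Eventually.of_forall hb)
  have hνuniv : ν.real Set.univ = 2 := by
    rw [measureReal_def, hν]
    simp only [Measure.coe_add, Pi.add_apply, measure_univ, Measure.smul_apply,
      Measure.coe_finsetSum, Finset.sum_apply, Finset.sum_const, Finset.card_univ,
      Fintype.card_fin, nsmul_eq_mul, mul_one, smul_eq_mul]
    rw [ENNReal.toReal_add (by simp) (by finiteness), ENNReal.toReal_mul,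
      ENNReal.toReal_ofReal (by positivity)]
    simp
    field_simp
    norm_num
  have hνint : ∫ e, err e ^ 2 ∂ν = ∫ e, err e ^ 2 ∂ρ + 1 / m * ∑ i, err (A i) ^ 2 := by
    rw [hν, integral_add_measure (hintg _) (hintg _), integral_smul_measure,
      integral_finsetSum_measure fun i _ => hintg _, ENNReal.toReal_ofReal (by positivity),
      smul_eq_mul]
    congr 2
    refine Finset.sum_congr rfl fun i _ => ?_
    rw [integral_dirac' _ _ (by fun_prop : Measurable fun e => err e ^ 2).stronglyMeasurable]
  have hκ' : ∫ e, err e ^ 2 ∂ρ + 1 / m * ∑ i, err (A i) ^ 2 ≤ 2 * N * L ^ 2 := by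
    rw [← hνint]
    refine hκ.trans (le_of_eq ?_)
    rw [hνuniv]; ring
  have hnonneg1 : 0 ≤ ∫ e, err e ^ 2 ∂ρ := integral_nonneg fun e => sq_nonneg _
  have hnonneg2 : 0 ≤ 1 / (m : ℝ) * ∑ i, err (A i) ^ 2 :=
    mul_nonneg (by positivity) (Finset.sum_nonneg fun i _ => sq_nonneg _)
  have hlarge : p / 4 ≤ ρ.real (largeSet g τ κ) := by
    have hsub : {e | τ ≤ |D e|} ⊆
        largeSet g τ κ ∪ {e | (N * τ / 2) ^ 2 ≤ err e ^ 2} := by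
      intro e he
      by_contra hcon
      simp only [largeSet, Set.mem_union, Set.mem_ofPred_eq, not_or, not_le] at hcon he
      obtain ⟨h1, h2⟩ := hcon
      have h3 : |err e| < N * τ / 2 := abs_lt_of_sq_lt_sq h2 (by positivity)
      have h4 : N * |D e| ≤ |∑ l, g (κ l) e| + |err e| := by
        have : (N : ℝ) * D e = ∑ l, g (κ l) e - err e := by simp only [herr]; ring
        rw [← Nat.abs_cast N, ← abs_mul, this]
        exact abs_sub _ _
      nlinarith
    have hmk := mul_meas_ge_le_integral_of_nonneg (μ := ρ) (f := fun e => err e ^ 2)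
      (Filter.Eventually.of_forall fun e => sq_nonneg _) (hintg ρ) ((N * τ / 2) ^ 2)
    have h5 := hD.trans ((measureReal_mono hsub (measure_ne_top _ _)).trans
      (measureReal_union_le _ _))
    have h6 : ρ.real {e | (N * τ / 2) ^ 2 ≤ err e ^ 2} ≤ p / 4 := by
      have h7 : (N * τ / 2) ^ 2 * ρ.real {e | (N * τ / 2) ^ 2 ≤ err e ^ 2} ≤
          (N * τ / 2) ^ 2 * (p / 4) := by
        refine hmk.trans ?_
        have : (N * τ / 2) ^ 2 * (p / 4) = N / 16 * (N * p * τ ^ 2) := by ring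
        rw [this]
        nlinarith [mul_le_mul_of_nonneg_left hNL hN0.le, sq_nonneg L]
      exact le_of_mul_le_mul_left h7 (by positivity)
    linarith
  have hcount := hA κ hlarge
  have hpt : ∀ i, (largeSet g τ κ).indicator (fun _ => (1 : ℝ)) (A i) ≤
      16 / τ ^ 2 * D (A i) ^ 2 + 16 / (N ^ 2 * τ ^ 2) * err (A i) ^ 2 := by
    intro i
    by_cases hi : A i ∈ largeSet g τ κ
    · rw [Set.indicator_of_mem hi]
      simp only [largeSet, Set.mem_ofPred_eq] at hi
      have h4 : |∑ l, g (κ l) (A i)| ≤ N * |D (A i)| + |err (A i)| := by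
        have : ∑ l, g (κ l) (A i) = N * D (A i) + err (A i) := by simp only [herr]; ring
        rw [this]
        refine (abs_add_le _ _).trans ?_
        rw [abs_mul, Nat.abs_cast]
      rw [← sq_abs (D _), ← sq_abs (err _)]
      rcases le_or_gt (τ / 4) |D (A i)| with h | h
      · have : 1 ≤ 16 / τ ^ 2 * |D (A i)| ^ 2 := by
          rw [div_mul_eq_mul_div, le_div_iff₀ (by positivity)]
          nlinarith
        have : 0 ≤ 16 / (N ^ 2 * τ ^ 2) * |err (A i)| ^ 2 := by positivity
        linarith
      · have h5 : N * τ / 4 ≤ |err (A i)| := by nlinarith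
        have : 1 ≤ 16 / (N ^ 2 * τ ^ 2) * |err (A i)| ^ 2 := by
          rw [div_mul_eq_mul_div, le_div_iff₀ (by positivity)]
          have : (N * τ / 4) ^ 2 ≤ |err (A i)| ^ 2 := pow_le_pow_left₀ (by positivity) h5 2
          nlinarith
        have : 0 ≤ 16 / τ ^ 2 * |D (A i)| ^ 2 := by positivity
        linarith
    · rw [Set.indicator_of_notMem hi]
      positivity
  have hsumle := Finset.sum_le_sum fun i (_ : i ∈ Finset.univ) => hpt i
  rw [Finset.sum_add_distrib, ← Finset.mul_sum, ← Finset.mul_sum] at hsumle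
  have herrsum : ∑ i, err (A i) ^ 2 ≤ m * (2 * N * L ^ 2) := by
    have : 1 / (m : ℝ) * ∑ i, err (A i) ^ 2 ≤ 2 * N * L ^ 2 := by linarith
    rwa [div_mul_eq_mul_div, one_mul, div_le_iff₀ hm0, mul_comm] at this
  have h8 : 16 / (N ^ 2 * τ ^ 2) * ∑ i, err (A i) ^ 2 ≤ m * (p / 32) := by
    rw [div_mul_eq_mul_div, div_le_iff₀ (by positivity)]
    have := mul_le_mul_of_nonneg_left hNL (mul_nonneg hm0.le hN0.le)
    nlinarith
  have h9 : m * (p / 32) ≤ 16 / τ ^ 2 * ∑ i, D (A i) ^ 2 := by linarith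
  rw [div_mul_eq_mul_div, le_div_iff₀ (by positivity)] at h9
  linarith

lemma exists_signed_weights {T : Type*} [Fintype T] [Nonempty T] {u : T → ℝ}
    (hu : ∑ t, |u t| ≤ 1) :
    ∃ w : T × Bool → ℝ, (∀ x, 0 ≤ w x) ∧ ∑ x, w x = 1 ∧
      ∀ φ : T → ℝ, ∑ x : T × Bool, w x * ((if x.2 then 1 else -1) * φ x.1) = ∑ t, u t * φ t := by
  have hT : (0 : ℝ) < Fintype.card T := by exact_mod_cast Fintype.card_pos
  set δ : ℝ := (1 - ∑ t, |u t|) / (2 * Fintype.card T) with hδ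
  have hδ0 : 0 ≤ δ := div_nonneg (by linarith) (by positivity)
  refine ⟨fun x => (|u x.1| + (if x.2 then 1 else -1) * u x.1) / 2 + δ, fun x => ?_, ?_, fun φ => ?_⟩
  · have h1 := neg_abs_le (u x.1)
    have h2 := le_abs_self (u x.1)
    dsimp only
    split_ifs <;> linarith
  · rw [Fintype.sum_prod_type]
    have : ∀ t, ∑ b : Bool, ((|u t| + (if b then 1 else -1) * u t) / 2 + δ) = |u t| + 2 * δ := by
      intro t
      simp only [Fintype.sum_bool, if_true, Bool.false_eq_true, if_false]
      ring
    rw [Finset.sum_congr rfl fun t _ => this t]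
    simp only [Finset.sum_add_distrib, Finset.sum_const, Finset.card_univ, nsmul_eq_mul, hδ]
    field_simp
    ring
  · rw [Fintype.sum_prod_type]
    refine Finset.sum_congr rfl fun t _ => ?_
    simp only [Fintype.sum_bool, if_true, Bool.false_eq_true, if_false]
    ring

/-- The signed frequency forms, truncated to the regular set. -/
def signedForm (n : ℕ) (x : Fin (2 * n) × Bool) (e : Fin n → ℝ) : ℝ :=
  (if x.2 then 1 else -1) *
    (regularSet n (1000 * Real.log n)).indicator (fun y => freqForm (freq n x.1) y) e

lemma measurable_signedForm (n : ℕ) (x : Fin (2 * n) × Bool) : Measurable (signedForm n x) :=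
  ((measurable_freqForm _).indicator (measurableSet_regularSet n _)).const_mul _

lemma abs_signedForm_le {n : ℕ} (hn : 2 ≤ n) (x : Fin (2 * n) × Bool) (e : Fin n → ℝ) :
    |signedForm n x e| ≤ 17 * (1000 * Real.log n) ^ 2 * Real.log n := by
  have hlog : 0 ≤ Real.log n := Real.log_natCast_nonneg n
  have hsign : |(if x.2 then 1 else -1 : ℝ)| = 1 := by split_ifs <;> simp
  rw [signedForm, abs_mul, hsign, one_mul]
  by_cases he : e ∈ regularSet n (1000 * Real.log n)
  · rw [Set.indicator_of_mem he]
    exact abs_freqForm_le_of_mem hn he _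
  · rw [Set.indicator_of_notMem he, abs_zero]
    positivity

lemma UnitMoments.of_sampling {μ : Measure ℝ} (h : SubGaussianSamplingDist μ)
    (h4 : ∫ x, x ^ 4 ∂μ ≤ 3) : UnitMoments μ where
  prob := h.1
  mean := h.2.2.1
  second := h.2.2.2.1
  integrable := by
    by_contra hintg
    have := h.2.2.2.2
    rw [integral_undef hintg] at this
    linarith
  fourth := h4

/-- A well-sampled design satisfies a lower isometry bound on Toeplitz matrices with controlled
spectral coefficients. -/
lemma sum_sq_quad_lower {μ : Measure ℝ} (hμ : UnitMoments μ) {n r m N : ℕ} (hn : 2 ≤ n)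
    (hr : 1 ≤ r) (hN : 0 < N) (hm : 0 < m)
    (hNL : 1024 * (17 * (1000 * Real.log n) ^ 2 * Real.log n) ^ 2 ≤
      N * (1 / 10000) * (1 / (100 * √r)) ^ 2) {A : Fin m → Fin n → ℝ}
    (hA : A ∈ wellSampled (Measure.pi fun _ : Fin n => μ) (signedForm n) (1 / (100 * √r))
      (1 / 10000) N m) {H : Matrix (Fin n) (Fin n) ℝ} (hT : IsToeplitz H) (hS : H.IsSymm)
    (hc : ∑ t, |specCoeff H t| ≤ 2 * √r * √(∑ i, ∑ j, H i j ^ 2)) :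
    m * (∑ i, ∑ j, H i j ^ 2) ≤ 12800000000 * ∑ i, (A i ⬝ᵥ H.mulVec (A i)) ^ 2 := by
  have := hμ.prob
  rcases (show 0 ≤ ∑ i, ∑ j, H i j ^ 2 by positivity).eq_or_lt with h0 | hpos
  · rw [← h0, mul_zero]
    positivity
  set F := √(∑ i, ∑ j, H i j ^ 2) with hF
  have hF0 : 0 < F := Real.sqrt_pos.2 hpos
  have hr0 : (0 : ℝ) < r := by exact_mod_cast hr
  have hsr : 0 < √(r : ℝ) := Real.sqrt_pos.2 hr0
  have hκ : 0 < 2 * √r * F := by positivity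
  have hne : Nonempty (Fin (2 * n)) := ⟨⟨0, by omega⟩⟩
  obtain ⟨w, hw, hw1, hwφ⟩ := exists_signed_weights (u := fun t => specCoeff H t / (2 * √r * F))
    (by
      simp only [abs_div, abs_of_pos hκ, ← Finset.sum_div]
      rw [div_le_one hκ]
      exact hc)
  have hval : ∀ e, ∑ x, w x * signedForm n x e = (regularSet n (1000 * Real.log n)).indicator
      (fun y => (y ⬝ᵥ H.mulVec y) / (2 * √r * F)) e := by
    intro e
    simp only [signedForm]
    rw [hwφ fun t => (regularSet n (1000 * Real.log n)).indicator
      (fun y => freqForm (freq n t) y) e]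
    by_cases he : e ∈ regularSet n (1000 * Real.log n)
    · simp only [Set.indicator_of_mem he]
      rw [dotProduct_mulVec_eq_sum_specCoeff hn hT hS, Finset.sum_div]
      exact Finset.sum_congr rfl fun t _ => by ring
    · simp only [Set.indicator_of_notMem he, mul_zero, Finset.sum_const_zero]
  have hball := quad_smallBall hμ (by omega) H (H ⟨0, by omega⟩ ⟨0, by omega⟩)
    (fun i => hT _ _ _ _ (by simp)) (fun i j => hS.apply j i) hpos
  have hlarge : (1 / 10000 : ℝ) / 2 ≤ (Measure.pi fun _ : Fin n => μ).real
      {e | 1 / (100 * √r) ≤ |∑ x, w x * signedForm n x e|} := by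
    have hsub : {x : Fin n → ℝ | √(∑ i, ∑ j, H i j ^ 2) / 50 ≤ |x ⬝ᵥ H.mulVec x|} ⊆
        {e | 1 / (100 * √r) ≤ |∑ x, w x * signedForm n x e|} ∪
          (regularSet n (1000 * Real.log n))ᶜ := by
      intro e he
      by_cases hreg : e ∈ regularSet n (1000 * Real.log n)
      · left
        rw [Set.mem_ofPred_eq] at he ⊢
        rw [hval, Set.indicator_of_mem hreg, abs_div, abs_of_pos hκ, le_div_iff₀ hκ]
        refine le_trans (le_of_eq ?_) he
        rw [← hF]
        field_simp
        norm_num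
      · exact Or.inr hreg
    have h1 := (measureReal_mono (μ := Measure.pi fun _ : Fin n => μ) hsub
      (measure_ne_top _ _)).trans (measureReal_union_le _ _)
    have h2 := regularSet_compl_le hμ hn
    linarith
  have hmain := le_sum_sq_of_wellSampled (measurable_signedForm n) (abs_signedForm_le hn)
    (by positivity) hN hm hNL hA hw hw1 hlarge
  have hupper : ∑ i, (∑ x, w x * signedForm n x (A i)) ^ 2 ≤
      (∑ i, (A i ⬝ᵥ H.mulVec (A i)) ^ 2) / (2 * √r * F) ^ 2 := by
    rw [Finset.sum_div]
    refine Finset.sum_le_sum fun i _ => ?_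
    rw [hval, ← div_pow]
    by_cases hreg : A i ∈ regularSet n (1000 * Real.log n)
    · rw [Set.indicator_of_mem hreg]
    · rw [Set.indicator_of_notMem hreg, zero_pow two_ne_zero]
      positivity
  have h := hmain.trans hupper
  rw [le_div_iff₀ (by positivity)] at h
  have hFsq : F ^ 2 = ∑ i, ∑ j, H i j ^ 2 := Real.sq_sqrt hpos.le
  have hrsq : √(r : ℝ) ^ 2 = r := Real.sq_sqrt hr0.le
  have hexp : (m : ℝ) * (1 / 10000 * (1 / (100 * √r)) ^ 2 / 512) * (2 * √r * F) ^ 2 =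
      m * F ^ 2 / 12800000000 := by
    field_simp
    norm_num
  rw [hexp, hFsq] at h
  linarith

lemma vecL2_sub_le {m : ℕ} (u v : Fin m → ℝ) : vecL2 (fun i => u i - v i) ≤ vecL2 u + vecL2 v := by
  have h := norm_sub_le (WithLp.toLp 2 u) (WithLp.toLp 2 v)
  simpa [EuclideanSpace.norm_eq, vecL2] using h

lemma quadMeas_sub {n m : ℕ} (A : Fin m → Fin n → ℝ) (X Y : Matrix (Fin n) (Fin n) ℝ) (i : Fin m) :
    quadMeas A (X - Y) i = quadMeas A X i - quadMeas A Y i := by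
  simp [quadMeas, Matrix.sub_mulVec, dotProduct_sub]

/-- On a well-sampled design the trace minimizer is close to the true matrix. -/
lemma frobNorm_sub_le_of_wellSampled {μ : Measure ℝ} (hμ : UnitMoments μ) {n r m N : ℕ}
    (hn : 2 ≤ n) (hr : 1 ≤ r) (hN : 0 < N) (hm : 0 < m)
    (hNL : 1024 * (17 * (1000 * Real.log n) ^ 2 * Real.log n) ^ 2 ≤
      N * (1 / 10000) * (1 / (100 * √r)) ^ 2) {A : Fin m → Fin n → ℝ}
    (hA : A ∈ wellSampled (Measure.pi fun _ : Fin n => μ) (signedForm n) (1 / (100 * √r))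
      (1 / 10000) N m) {S Shat : Matrix (Fin n) (Fin n) ℝ} {ε : ℝ} {η : Fin m → ℝ}
    (hS : S.PosSemidef) (hST : IsToeplitz S) (hrank : S.rank ≤ r) (hη : vecL2 η ≤ ε)
    (hSh : Shat.PosSemidef) (hShT : IsToeplitz Shat)
    (hfeas : vecL2 (fun i => quadMeas A S i + η i - quadMeas A Shat i) ≤ ε)
    (htr : Shat.trace ≤ S.trace) :
    frobNorm (Shat - S) ≤ 300000 * ε / √m := by
  have hε : 0 ≤ ε := (Real.sqrt_nonneg _).trans hη
  have hherm : (Shat - S).IsHermitian := hSh.isHermitian.sub hS.isHermitian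
  have hsymm : (Shat - S).IsSymm := by
    ext i j
    simpa using congrFun (congrFun hherm i) j
  have hcoeff := sum_abs_specCoeff_le (by omega) hherm
    (by rw [Matrix.trace_sub]; linarith) hrank (fun x hx => by
      rw [Matrix.sub_mulVec, hx, sub_zero]
      simpa using hSh.dotProduct_mulVec_nonneg x)
  have hlow := sum_sq_quad_lower hμ hn hr hN hm hNL hA
    (fun i j k l h => by rw [Matrix.sub_apply, Matrix.sub_apply, hST i j k l h, hShT i j k l h])
    hsymm hcoeff
  have hres : vecL2 (quadMeas A (Shat - S)) ≤ 2 * ε := by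
    have h := vecL2_sub_le η fun i => quadMeas A S i + η i - quadMeas A Shat i
    have heq : (fun i => η i - (quadMeas A S i + η i - quadMeas A Shat i)) =
        quadMeas A (Shat - S) := by
      funext i
      rw [quadMeas_sub]
      ring
    rw [heq] at h
    linarith
  have hsum : ∑ i, (A i ⬝ᵥ (Shat - S).mulVec (A i)) ^ 2 ≤ (2 * ε) ^ 2 :=
    (Real.sqrt_le_left (by positivity)).1 hres
  have hm0 : (0 : ℝ) < m := by exact_mod_cast hm
  rw [le_div_iff₀ (Real.sqrt_pos.2 hm0), frobNorm, ← Real.sqrt_mul (by positivity)]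
  refine Real.sqrt_le_iff.2 ⟨by positivity, ?_⟩
  nlinarith [sq_nonneg ε]

/-- The sample size condition makes the failure probability of the net argument small. -/
lemma exists_net_size {n r m : ℕ} (hn : 2 ≤ n) (hr : 1 ≤ r)
    (hm : 10 ^ 33 * (r : ℝ) * Real.log n ^ 10 < m) :
    ∃ N : ℕ, 0 < N ∧ 0 < m ∧
      1024 * (17 * (1000 * Real.log n) ^ 2 * Real.log n) ^ 2 ≤
        N * (1 / 10000) * (1 / (100 * √r)) ^ 2 ∧
      (Fintype.card (Fin (2 * n) × Bool) : ℝ) ^ N * Real.exp (-((1 / 10000 : ℝ) / 16 * m)) ≤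
        1 / (n : ℝ) ^ 2 := by
  have hr1 : (1 : ℝ) ≤ r := by exact_mod_cast hr
  have hn2 : (2 : ℝ) ≤ n := by exact_mod_cast hn
  have hlog : 2 / 3 ≤ Real.log n := by
    have h1 := Real.log_two_gt_d9
    have h2 := Real.log_le_log (by norm_num) hn2
    linarith
  set l := Real.log n with hl
  have hl0 : 0 < l := by linarith
  have hm0 : (0 : ℝ) < m := lt_of_le_of_lt (by positivity) hm
  set Q : ℝ := 102400000000 * r * (17 * (1000 * l) ^ 2 * l) ^ 2 with hQ
  have hQ0 : 0 < Q := by positivity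
  have hrsq : √(r : ℝ) ^ 2 = r := Real.sq_sqrt (by linarith)
  have hl6 : 8 / 100 ≤ l ^ 6 := by
    calc (8 / 100 : ℝ) ≤ (2 / 3) ^ 6 := by norm_num
      _ ≤ l ^ 6 := by gcongr
  have hl3 : 8 / 27 ≤ l ^ 3 := by
    calc (8 / 27 : ℝ) ≤ (2 / 3) ^ 3 := by norm_num
      _ ≤ l ^ 3 := by gcongr
  refine ⟨⌈Q⌉₊, Nat.ceil_pos.2 hQ0, by exact_mod_cast hm0, ?_, ?_⟩
  · have hceil := Nat.le_ceil Q
    rw [show (⌈Q⌉₊ : ℝ) * (1 / 10000) * (1 / (100 * √r)) ^ 2 =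
      ⌈Q⌉₊ / (100000000 * r) by rw [div_pow, mul_pow, hrsq]; field_simp; norm_num]
    rw [le_div_iff₀ (by positivity)]
    refine le_trans (le_of_eq ?_) hceil
    rw [hQ]
    ring
  · have hceil : (⌈Q⌉₊ : ℝ) ≤ 10 ^ 26 * (r * l ^ 6) := by
      have h1 := (Nat.ceil_lt_add_one hQ0.le).le
      have h2 : (8 / 100 : ℝ) ≤ r * l ^ 6 := by nlinarith
      have h3 : Q = 102400000000 * 289000000000000 * (r * l ^ 6) := by rw [hQ]; ring
      linarith
    have hcard : (Fintype.card (Fin (2 * n) × Bool) : ℝ) = 4 * n := by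
      simp [Fintype.card_prod]
      ring
    have hcard_le : (4 * n : ℝ) ≤ Real.exp (3 * l) := by
      rw [mul_comm 3 l, Real.exp_mul, hl, Real.exp_log (by linarith)]
      norm_cast
      nlinarith [mul_le_mul hn hn (by norm_num) (by omega)]
    have hinv : 1 / (n : ℝ) ^ 2 = Real.exp (-(2 * l)) := by
      rw [Real.exp_neg, mul_comm 2 l, Real.exp_mul, hl, Real.exp_log (by linarith), one_div]
      norm_cast
    rw [hcard, hinv]
    calc (4 * n : ℝ) ^ ⌈Q⌉₊ * Real.exp (-((1 / 10000 : ℝ) / 16 * m))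
        ≤ Real.exp (3 * l) ^ ⌈Q⌉₊ * Real.exp (-((1 / 10000 : ℝ) / 16 * m)) := by gcongr
      _ = Real.exp (⌈Q⌉₊ * (3 * l) - (1 / 10000 : ℝ) / 16 * m) := by
        rw [← Real.exp_nat_mul, ← Real.exp_add, sub_eq_add_neg]
      _ ≤ Real.exp (-(2 * l)) := by
        refine Real.exp_le_exp.2 ?_
        have hN : (⌈Q⌉₊ : ℝ) * (3 * l) ≤ 10 ^ 26 * (r * l ^ 6) * (3 * l) := by gcongr
        have hN2 : 10 ^ 26 * (r * l ^ 6) * (3 * l) ≤ 11 * 10 ^ 26 * (r * l ^ 10) := by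
          have : 0 ≤ r * l ^ 7 * (l ^ 3 - 8 / 27) := by
            have : 0 ≤ l ^ 3 - 8 / 27 := by linarith
            positivity
          have h0 : 0 ≤ r * l ^ 10 := by positivity
          nlinarith
        have hl9 : (1 / 100 : ℝ) ≤ r * l ^ 9 := by
          have : (1 / 100 : ℝ) ≤ l ^ 9 := by
            calc (1 / 100 : ℝ) ≤ (2 / 3) ^ 9 := by norm_num
              _ ≤ l ^ 9 := by gcongr
          nlinarith
        have hN3 : 2 * l ≤ 200 * (r * l ^ 10) := by nlinarith
        have h0 : 0 ≤ r * l ^ 10 := by positivity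
        linarith

/-- **Theorem 2 (Toeplitz low-rank covariance recovery from quadratic measurements).** -/
theorem toeplitz_low_rank_covariance_recovery :
    ∃ c0 C2 : ℝ, 0 < c0 ∧ 0 < C2 ∧
      ∀ (n r m : ℕ), 2 ≤ n → 1 ≤ r → c0 * (r : ℝ) * Real.log n ^ 10 < (m : ℝ) →
      ∀ (Ω : Type) (_ : MeasurableSpace Ω) (P : Measure Ω), IsProbabilityMeasure P →
      ∀ μ : Measure ℝ, SubGaussianSamplingDist μ → (∫ x, x ^ 4 ∂μ) ≤ 3 →
      ∀ a : Fin m → Ω → Fin n → ℝ, SamplingModel P a μ →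
      ENNReal.ofReal (1 - 1 / (n : ℝ) ^ 2) ≤
        P {ω | ∀ (S Shat : Matrix (Fin n) (Fin n) ℝ) (ε2 : ℝ) (η : Fin m → ℝ),
            S.PosSemidef → S.IsSymm → IsToeplitz S → S.rank ≤ r →
            0 ≤ ε2 → vecL2 η ≤ ε2 →
            Shat.PosSemidef → IsToeplitz Shat →
            vecL2 (fun i => (quadMeas (fun k => a k ω) S i + η i) -
              quadMeas (fun k => a k ω) Shat i) ≤ ε2 →
            (∀ M : Matrix (Fin n) (Fin n) ℝ, M.PosSemidef → IsToeplitz M →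
              vecL2 (fun i => (quadMeas (fun k => a k ω) S i + η i) -
                quadMeas (fun k => a k ω) M i) ≤ ε2 → Shat.trace ≤ M.trace) →
            frobNorm (Shat - S) ≤ C2 * ε2 / Real.sqrt (m : ℝ)} := by
  refine ⟨10 ^ 33, 300000, by norm_num, by norm_num, ?_⟩
  intro n r m hn hr hm Ω _ P _ μ hμ h4 a ha
  have hU := UnitMoments.of_sampling hμ h4
  have := hU.prob
  obtain ⟨N, hN, hm0, hNL, hfail⟩ := exists_net_size hn hr hm
  set W := wellSampled (Measure.pi fun _ : Fin n => μ) (signedForm n) (1 / (100 * √r))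
    (1 / 10000) N m
  have hWm : MeasurableSet W := measurableSet_wellSampled (measurable_signedForm n) _ _ _ _
  have hmeas : Measurable fun ω i => a i ω :=
    measurable_pi_lambda _ fun i => measurable_pi_lambda _ fun j => ha.1 i j
  have hlaw := map_eq_pi_pi_of_iIndepFun ha.1 ha.2.1 ha.2.2
  have hWc := (wellSampled_compl_le (ρ := Measure.pi fun _ : Fin n => μ) (measurable_signedForm n)
    (1 / (100 * √r)) (1 / 10000) N m).trans hfail
  have hW : 1 - 1 / (n : ℝ) ^ 2 ≤ P.real ((fun ω i => a i ω) ⁻¹' W) := by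
    rw [← map_measureReal_apply hmeas hWm, hlaw]
    have := probReal_compl_eq_one_sub (μ := Measure.pi fun _ : Fin m =>
      Measure.pi fun _ : Fin n => μ) hWm
    linarith
  refine (ENNReal.ofReal_le_iff_le_toReal (measure_ne_top _ _)).2 hW |>.trans (measure_mono ?_)
  intro ω hω S Shat ε η hS _ hST hrank _ hη hSh hShT hfeas hmin
  refine frobNorm_sub_le_of_wellSampled hU hn hr hN hm0 hNL hω hS hST hrank hη hSh hShT hfeas
    (hmin S hS hST ?_)
  simpa using hη
end
end

section
/- Let a_1, a_2, a_3 be independent random vectors in ℝ^n, each with i.i.d. entries having mean 0, variance 1, and fourth moment μ4 with 1 < μ4 < 3 (all moments up to order four finite), and set A_j := a_j a_j^T. Take any ξ > 0 with ξ² > 1.5·(3 − μ4), set Δ := −(1 − ξ/√n)² − 2 + 2ξ²/(3 − μ4), α := √((3 − μ4)/(2ξ²)), β := α·(−(1 − ξ/√n) + √Δ)/2, γ := α·(−(1 − ξ/√n) − √Δ)/2, and B := α·A_1 + β·A_2 + γ·A_3. Then: (a) E[B] = √((3 − μ4)/(2n))·I_n; (b) for every symmetric X ∈ ℝ^{n×n}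 with all diagonal entries equal (X_{11} = X_{22} = … = X_{nn}), E[ B·⟨B, X⟩ ] = X; and (c) for any norm ‖·‖_n on ℝ^{n×n}, ‖B‖_n ≤ √3·max{ ‖A_1‖_n, ‖A_2‖_n, ‖A_3‖_n }. -/
open MeasureTheory ProbabilityTheory Matrix

noncomputable section

/-- Frobenius inner product `⟨Y, X⟩ = trace (Yᵀ X)`. -/
def finner {n : ℕ} (Y X : Matrix (Fin n) (Fin n) ℝ) : ℝ := ∑ i, ∑ j, Y i j * X i j

section Moments

variable {Ω ι : Type*} [MeasurableSpace Ω] {P : Measure Ω} {μ : Measure ℝ} {Y : ι → Ω → ℝ}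

lemma integral_pow_of_map_eq (hY : ∀ p, Measurable (Y p)) (hmap : ∀ p, P.map (Y p) = μ)
    (p : ι) (k : ℕ) : ∫ ω, Y p ω ^ k ∂P = ∫ x, x ^ k ∂μ := by
  rw [← hmap p, integral_map (hY p).aemeasurable (by fun_prop)]

lemma integrable_pow_of_map_eq (hY : ∀ p, Measurable (Y p)) (hmap : ∀ p, P.map (Y p) = μ)
    (p : ι) {k : ℕ} (hk : Integrable (fun x => x ^ k) μ) :
    Integrable (fun ω => Y p ω ^ k) P := by
  rw [← hmap p] at hk
  exact hk.comp_measurable (hY p)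

lemma integrable_mul_of_integrable_sq (hY : ∀ p, Measurable (Y p))
    (hmap : ∀ p, P.map (Y p) = μ) (h2 : Integrable (fun x => x ^ 2) μ) (u v : ι) :
    Integrable (fun ω => Y u ω * Y v ω) P := by
  have h := fun p => integrable_pow_of_map_eq hY hmap p h2
  refine ((h u).add (h v)).mono' ((hY u).mul (hY v)).aestronglyMeasurable (.of_forall fun ω => ?_)
  rw [Real.norm_eq_abs, abs_le]
  simp only [Pi.add_apply]
  constructor <;> nlinarith [sq_nonneg (Y u ω + Y v ω), sq_nonneg (Y u ω - Y v ω)]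

lemma integrable_mul_mul_mul_of_integrable_pow_four (hY : ∀ p, Measurable (Y p))
    (hmap : ∀ p, P.map (Y p) = μ) (h4 : Integrable (fun x => x ^ 4) μ) (u v w z : ι) :
    Integrable (fun ω => Y u ω * Y v ω * (Y w ω * Y z ω)) P := by
  have h := fun p => integrable_pow_of_map_eq hY hmap p h4
  refine (((h u).add (h v)).add ((h w).add (h z))).mono'
    (((hY u).mul (hY v)).mul ((hY w).mul (hY z))).aestronglyMeasurable (.of_forall fun ω => ?_)
  rw [Real.norm_eq_abs, abs_le]
  simp only [Pi.add_apply]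
  constructor <;>
    nlinarith [sq_nonneg (Y u ω * Y v ω + Y w ω * Y z ω), sq_nonneg (Y u ω * Y v ω - Y w ω * Y z ω),
      sq_nonneg (Y u ω ^ 2 - Y v ω ^ 2), sq_nonneg (Y w ω ^ 2 - Y z ω ^ 2),
      sq_nonneg (Y u ω ^ 2), sq_nonneg (Y v ω ^ 2), sq_nonneg (Y w ω ^ 2), sq_nonneg (Y z ω ^ 2)]

variable [Fintype ι]

lemma integral_prod_pow_of_iIndepFun (hY : ∀ p, Measurable (Y p)) (hind : iIndepFun Y P)
    (hmap : ∀ p, P.map (Y p) = μ) (d : ι → ℕ) :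
    ∫ ω, ∏ p, Y p ω ^ d p ∂P = ∏ p, ∫ x, x ^ d p ∂μ := by
  rw [hind.integral_fun_prod_comp (f := fun p x => x ^ d p) (fun p => (hY p).aemeasurable)
    (fun p => by fun_prop)]
  exact Finset.prod_congr rfl fun p _ => integral_pow_of_map_eq hY hmap p _

variable [DecidableEq ι]

lemma integral_mul_of_iIndepFun [IsProbabilityMeasure μ] (hY : ∀ p, Measurable (Y p))
    (hind : iIndepFun Y P) (hmap : ∀ p, P.map (Y p) = μ)
    (hmean : (∫ x, x ∂μ) = 0) (hvar : (∫ x, x ^ 2 ∂μ) = 1) (u v : ι) :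
    ∫ ω, Y u ω * Y v ω ∂P = if u = v then 1 else 0 := by
  split_ifs with h
  · subst h
    rw [← hvar, ← integral_pow_of_map_eq hY hmap u 2]
    simp only [sq]
  · have key := integral_prod_pow_of_iIndepFun hY hind hmap (Pi.single u 1 + Pi.single v 1)
    simp only [Pi.add_apply, pow_add, Finset.prod_mul_distrib, Pi.single_apply, pow_ite, pow_one,
      pow_zero, Finset.prod_ite_eq', Finset.mem_univ, if_true] at key
    rw [key]
    exact Finset.prod_eq_zero (Finset.mem_univ u) (by simp [h, hmean])

/-- A fourth-order mixed moment vanishes as soon as one factor is independent of the others. -/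
lemma integral_mul_mul_mul_eq_zero_of_ne (hY : ∀ p, Measurable (Y p)) (hind : iIndepFun Y P)
    (hmap : ∀ p, P.map (Y p) = μ) (hmean : (∫ x, x ∂μ) = 0) {u v w z : ι}
    (hv : u ≠ v) (hw : u ≠ w) (hz : u ≠ z) :
    ∫ ω, Y u ω * Y v ω * (Y w ω * Y z ω) ∂P = 0 := by
  have key := integral_prod_pow_of_iIndepFun hY hind hmap
    (Pi.single u 1 + Pi.single v 1 + (Pi.single w 1 + Pi.single z 1))
  simp only [Pi.add_apply, pow_add, Finset.prod_mul_distrib, Pi.single_apply, pow_ite, pow_one,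
    pow_zero, Finset.prod_ite_eq', Finset.mem_univ, if_true] at key
  rw [key]
  exact Finset.prod_eq_zero (Finset.mem_univ u) (by simp [hv, hw, hz, hmean])

lemma integral_sq_mul_sq_of_ne [IsProbabilityMeasure μ] (hY : ∀ p, Measurable (Y p))
    (hind : iIndepFun Y P) (hmap : ∀ p, P.map (Y p) = μ) (hvar : (∫ x, x ^ 2 ∂μ) = 1) {u w : ι}
    (h : u ≠ w) : ∫ ω, Y u ω ^ 2 * Y w ω ^ 2 ∂P = 1 := by
  have key := integral_prod_pow_of_iIndepFun hY hind hmap (Pi.single u 2 + Pi.single w 2)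
  simp only [Pi.add_apply, pow_add, Finset.prod_mul_distrib, Pi.single_apply, pow_ite,
    pow_zero, Finset.prod_ite_eq', Finset.mem_univ, if_true] at key
  rw [key]
  refine Finset.prod_eq_one fun p _ => ?_
  by_cases hu : p = u
  · subst hu; simp [h, hvar]
  · by_cases hw : p = w <;> simp [hu, hw, hvar, h.symm]

lemma integral_mul_mul_mul_of_iIndepFun [IsProbabilityMeasure μ] (hY : ∀ p, Measurable (Y p))
    (hind : iIndepFun Y P) (hmap : ∀ p, P.map (Y p) = μ)
    (hmean : (∫ x, x ∂μ) = 0) (hvar : (∫ x, x ^ 2 ∂μ) = 1) (u v w z : ι) :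
    ∫ ω, Y u ω * Y v ω * (Y w ω * Y z ω) ∂P =
      (if u = v then if w = z then 1 else 0 else 0) + (if u = w then if v = z then 1 else 0 else 0) +
      (if u = z then if v = w then 1 else 0 else 0) +
      (if u = v then if u = w then if u = z then (∫ x, x ^ 4 ∂μ) - 3 else 0 else 0 else 0) := by
  have isolated := fun {u v w z : ι} => integral_mul_mul_mul_eq_zero_of_ne (u := u) (v := v)
    (w := w) (z := z) hY hind hmap hmean
  have pairs := fun {u w : ι} => integral_sq_mul_sq_of_ne (u := u) (w := w) hY hind hmap hvar
  by_cases huv : u = v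
  · subst huv
    by_cases hwz : w = z
    · subst hwz
      by_cases huw : u = w
      · subst huw
        have := integral_pow_of_map_eq hY hmap u 4
        simp only [if_true, ← this, ← sq, ← pow_mul]
        norm_num
      · simp [huw, ← pairs huw, sq]
    · by_cases huw : u = w
      · subst huw
        simp only [hwz, if_true, if_false, add_zero]
        rw [← isolated (u := z) (Ne.symm hwz) (Ne.symm hwz) (Ne.symm hwz)]
        congr 1; ext ω; ring
      · simp only [hwz, huw, if_false, ite_self, add_zero]
        rw [← isolated (u := w) (Ne.symm huw) (Ne.symm huw) hwz]
        congr 1; ext ω; ring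
  · by_cases huw : u = w
    · subst huw
      by_cases hvz : v = z
      · subst hvz
        simp only [huv, Ne.symm huv, if_true, if_false]
        rw [zero_add, add_zero, add_zero, ← pairs huv]
        congr 1; ext ω; ring
      · simp only [huv, hvz, Ne.symm huv, if_true, if_false, ite_self, add_zero]
        rw [← isolated (u := v) (Ne.symm huv) (Ne.symm huv) hvz]
        congr 1; ext ω; ring
    · by_cases huz : u = z
      · subst huz
        by_cases hvw : v = w
        · subst hvw
          simp only [huv, if_true, if_false]
          rw [zero_add, add_zero, zero_add, ← pairs huv]
          congr 1; ext ω; ring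
        · simp only [huv, huw, hvw, if_true, if_false, add_zero]
          rw [← isolated (u := v) (Ne.symm huv) (Ne.symm huv) hvw]
          congr 1; ext ω; ring
      · simp only [huv, huw, huz, if_false, add_zero]
        exact isolated huv huw huz

end Moments

lemma SamplingModel.integral_sum_vecMulVec {Ω : Type} [MeasurableSpace Ω] {P : Measure Ω}
    {μ : Measure ℝ} [IsProbabilityMeasure μ] {m n : ℕ} {a : Fin m → Ω → Fin n → ℝ}
    (ha : SamplingModel P a μ) (h2 : Integrable (fun x => x ^ 2) μ)
    (hmean : (∫ x, x ∂μ) = 0) (hvar : (∫ x, x ^ 2 ∂μ) = 1) (c : Fin m → ℝ) (i j : Fin n) :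
    ∫ ω, ∑ p, c p * (a p ω i * a p ω j) ∂P = if i = j then ∑ p, c p else 0 := by
  obtain ⟨hY, hind, hmap⟩ := ha
  have hY' : ∀ p : Fin m × Fin n, Measurable fun ω => a p.1 ω p.2 := fun p => hY _ _
  have hmap' : ∀ p : Fin m × Fin n, P.map (fun ω => a p.1 ω p.2) = μ := fun p => hmap _ _
  rw [integral_finsetSum _ fun p _ =>
    (integrable_mul_of_integrable_sq hY' hmap' h2 (p, i) (p, j)).const_mul _]
  simp_rw [integral_const_mul]
  have h := fun p : Fin m => integral_mul_of_iIndepFun hY' hind hmap' hmean hvar (p, i) (p, j)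
  simp only at h
  simp_rw [h]
  split_ifs with hij <;> simp [hij]

lemma SamplingModel.integral_sum_vecMulVec_mul_finner {Ω : Type} [MeasurableSpace Ω]
    {P : Measure Ω} {μ : Measure ℝ} [IsProbabilityMeasure μ] {m n : ℕ}
    {a : Fin m → Ω → Fin n → ℝ} (ha : SamplingModel P a μ)
    (h4 : Integrable (fun x => x ^ 4) μ) (hmean : (∫ x, x ∂μ) = 0)
    (hvar : (∫ x, x ^ 2 ∂μ) = 1) (c : Fin m → ℝ) (X : Matrix (Fin n) (Fin n) ℝ) (i j : Fin n) :
    ∫ ω, (∑ p, c p * (a p ω i * a p ω j)) *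
        finner (Matrix.of fun k l => ∑ q, c q * (a q ω k * a q ω l)) X ∂P =
      (if i = j then (∑ p, c p) ^ 2 * X.trace else 0) +
        (∑ p, c p ^ 2) *
          (X i j + X j i + if i = j then ((∫ x, x ^ 4 ∂μ) - 3) * X i i else 0) := by
  obtain ⟨hY, hind, hmap⟩ := ha
  have hY' : ∀ p : Fin m × Fin n, Measurable fun ω => a p.1 ω p.2 := fun p => hY _ _
  have hmap' : ∀ p : Fin m × Fin n, P.map (fun ω => a p.1 ω p.2) = μ := fun p => hmap _ _
  have hint := fun (p q : Fin m) (k l : Fin n) =>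
    (integrable_mul_mul_mul_of_integrable_pow_four hY' hmap' h4 (p, i) (p, j) (q, k) (q, l)).const_mul
      (c p * c q * X k l)
  have hval := fun (p q : Fin m) (k l : Fin n) =>
    integral_mul_mul_mul_of_iIndepFun hY' hind hmap' hmean hvar (p, i) (p, j) (q, k) (q, l)
  simp only at hint hval
  have hexp : ∀ ω, (∑ p, c p * (a p ω i * a p ω j)) *
        finner (Matrix.of fun k l => ∑ q, c q * (a q ω k * a q ω l)) X =
      ∑ k, ∑ l, ∑ p, ∑ q, c p * c q * X k l * (a p ω i * a p ω j * (a q ω k * a q ω l)) := by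
    intro ω
    simp only [finner, Matrix.of_apply, Finset.mul_sum, Finset.sum_mul]
    refine Finset.sum_congr rfl fun k _ => Finset.sum_congr rfl fun l _ => ?_
    rw [Finset.sum_comm]
    refine Finset.sum_congr rfl fun p _ => Finset.sum_congr rfl fun q _ => ?_
    ring
  simp_rw [hexp]
  rw [integral_finsetSum _ fun k _ => integrable_finsetSum _ fun l _ =>
    integrable_finsetSum _ fun p _ => integrable_finsetSum _ fun q _ => hint p q k l]
  simp_rw [integral_finsetSum _ fun l _ =>
    integrable_finsetSum _ fun p _ => integrable_finsetSum _ fun q _ => hint p q _ l]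
  simp_rw [integral_finsetSum _ fun p _ => integrable_finsetSum _ fun q _ => hint p q _ _]
  simp_rw [integral_finsetSum _ fun q _ => hint _ q _ _, integral_const_mul, hval]
  have hpq : ∀ k l : Fin n, ∑ p, ∑ q, c p * c q * X k l *
      ((if (p, i) = (p, j) then if (q, k) = (q, l) then 1 else 0 else 0) +
        (if (p, i) = (q, k) then if (p, j) = (q, l) then 1 else 0 else 0) +
        (if (p, i) = (q, l) then if (p, j) = (q, k) then 1 else 0 else 0) +
        (if (p, i) = (p, j) then if (p, i) = (q, k) then if (p, i) = (q, l) then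
          (∫ x, x ^ 4 ∂μ) - 3 else 0 else 0 else 0)) =
      (if i = j then if k = l then (∑ p, c p) ^ 2 * X k l else 0 else 0) +
      (∑ p, c p ^ 2) * ((if i = k then if j = l then X k l else 0 else 0) +
        (if i = l then if j = k then X k l else 0 else 0) +
        (if i = j then if i = k then if i = l then ((∫ x, x ^ 4 ∂μ) - 3) * X k l
          else 0 else 0 else 0)) := by
    intro k l
    have hs : (if i = j then if k = l then (∑ p, c p) ^ 2 * X k l else 0 else 0) =
        ∑ p, ∑ q, c p * c q * (if i = j then if k = l then X k l else 0 else 0) := by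
      simp_rw [← Finset.sum_mul, ← Finset.mul_sum, ← Finset.sum_mul]
      split_ifs <;> ring
    have hd : ∀ t : ℝ, (∑ p, c p ^ 2) * t = ∑ p, ∑ q, if p = q then c p * c q * t else 0 := by
      intro t
      simp [Finset.sum_mul, sq]
    rw [hs, hd]
    simp_rw [← Finset.sum_add_distrib]
    refine Finset.sum_congr rfl fun p _ => Finset.sum_congr rfl fun q _ => ?_
    by_cases h : p = q
    · subst h
      simp only [Prod.mk.injEq, true_and, if_true]
      split_ifs <;> ring
    · simp only [Prod.mk.injEq, true_and, h, false_and, if_false]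
      split_ifs <;> ring
  simp_rw [hpq, Finset.sum_add_distrib, ← Finset.mul_sum, Finset.sum_add_distrib]
  congr 1
  · split_ifs <;> simp [Matrix.trace, Finset.mul_sum]
  · congr 1
    by_cases hij : i = j <;> simp [hij]


/-- **Lemma 4.2 (isotropy of combined rank-one measurements when 1 < μ₄ < 3).** -/
theorem combined_isotropy_mu4_lt_three
    {n : ℕ} (Ω : Type) [MeasurableSpace Ω] (P : Measure Ω) [IsProbabilityMeasure P]
    (μ : Measure ℝ) [IsProbabilityMeasure μ]
    (hmom : ∀ k : ℕ, k ≤ 4 → Integrable (fun x => x ^ k) μ)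
    (hmean : (∫ x, x ∂μ) = 0) (hvar : (∫ x, x ^ 2 ∂μ) = 1)
    (μ4 : ℝ) (hμ4def : μ4 = ∫ x, x ^ 4 ∂μ) (hμ4lb : 1 < μ4) (hμ4ub : μ4 < 3)
    (a : Fin 3 → Ω → Fin n → ℝ) (ha : SamplingModel P a μ)
    (A : Fin 3 → Ω → Matrix (Fin n) (Fin n) ℝ)
    (hA : ∀ j ω, A j ω = Matrix.vecMulVec (a j ω) (a j ω))
    (ξ Δ α β γ : ℝ)
    (hξpos : 0 < ξ) (hξ : (3 / 2) * (3 - μ4) < ξ ^ 2)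
    (hΔ : Δ = -(1 - ξ / Real.sqrt (n : ℝ)) ^ 2 - 2 + 2 * ξ ^ 2 / (3 - μ4))
    (hΔ0 : 0 ≤ Δ)
    (hα : α = Real.sqrt ((3 - μ4) / (2 * ξ ^ 2)))
    (hβ : β = α * (-(1 - ξ / Real.sqrt (n : ℝ)) + Real.sqrt Δ) / 2)
    (hγ : γ = α * (-(1 - ξ / Real.sqrt (n : ℝ)) - Real.sqrt Δ) / 2)
    (B : Ω → Matrix (Fin n) (Fin n) ℝ)
    (hB : ∀ ω, B ω = α • A 0 ω + β • A 1 ω + γ • A 2 ω) :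
    ((Matrix.of fun i j => ∫ ω, B ω i j ∂P) =
        Real.sqrt ((3 - μ4) / (2 * (n : ℝ))) • (1 : Matrix (Fin n) (Fin n) ℝ)) ∧
    (∀ X : Matrix (Fin n) (Fin n) ℝ, X.IsSymm → (∀ i j : Fin n, X i i = X j j) →
        (Matrix.of fun i j => ∫ ω, B ω i j * finner (B ω) X ∂P) = X) ∧
    (∀ (N : Seminorm ℝ (Matrix (Fin n) (Fin n) ℝ)) (ω : Ω),
        N (B ω) ≤ Real.sqrt 3 * max (N (A 0 ω)) (max (N (A 1 ω)) (N (A 2 ω)))) := by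
  have hE : ∀ ω, B ω = Matrix.of fun k l => ∑ q, ![α, β, γ] q * (a q ω k * a q ω l) := by
    intro ω
    ext k l
    simp [hB, hA, Matrix.vecMulVec_apply, Fin.sum_univ_three]
  have h3 : 0 < 3 - μ4 := by linarith
  have hα2 : α ^ 2 = (3 - μ4) / (2 * ξ ^ 2) := by rw [hα, Real.sq_sqrt (by positivity)]
  have hsq : α ^ 2 + β ^ 2 + γ ^ 2 = 1 / 2 := by
    have : α ^ 2 + β ^ 2 + γ ^ 2 =
        α ^ 2 * (1 + ((1 - ξ / Real.sqrt (n : ℝ)) ^ 2 + Real.sqrt Δ ^ 2) / 2) := by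
      rw [hβ, hγ]; ring
    rw [this, Real.sq_sqrt hΔ0, hΔ, hα2]
    field_simp
    ring
  have hsum : α + β + γ = Real.sqrt ((3 - μ4) / (2 * (n : ℝ))) := by
    have h1 : α + β + γ = α * ξ / Real.sqrt n := by rw [hβ, hγ]; ring
    have h2 : α * ξ = Real.sqrt ((3 - μ4) / 2) := by
      rw [hα]
      nth_rw 2 [← Real.sqrt_sq hξpos.le]
      rw [← Real.sqrt_mul (by positivity)]
      congr 1
      field_simp
    rw [h1, h2, ← Real.sqrt_div (by positivity), div_div]
  refine ⟨?_, ?_, ?_⟩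
  · ext i j
    simp only [hE, Matrix.of_apply]
    rw [ha.integral_sum_vecMulVec (hmom 2 (by norm_num)) hmean hvar]
    simp [Fin.sum_univ_three, hsum, Matrix.one_apply]
  · intro X hX hdiag
    ext i j
    have hn : (n : ℝ) ≠ 0 := by exact_mod_cast (Fin.pos i).ne'
    have key := ha.integral_sum_vecMulVec_mul_finner (hmom 4 le_rfl) hmean hvar ![α, β, γ] X i j
    simp only [← hE] at key
    simp only [Matrix.of_apply]
    have hBe : ∀ ω, B ω i j = ∑ q, ![α, β, γ] q * (a q ω i * a q ω j) := fun ω => by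
      rw [hE]; rfl
    simp only [hBe]
    rw [key, ← hμ4def, hX.apply i j]
    have htr : X.trace = n * X i i := by
      simp [Matrix.trace, fun k => hdiag k i]
    simp only [Fin.sum_univ_three, Matrix.cons_val]
    rw [hsum, hsq, htr, Real.sq_sqrt (by positivity)]
    split_ifs with hij
    · subst hij
      field_simp
      ring
    · ring
  · intro N ω
    set M := max (N (A 0 ω)) (max (N (A 1 ω)) (N (A 2 ω))) with hM
    have h0 : N (A 0 ω) ≤ M := le_max_left _ _
    have h1 : N (A 1 ω) ≤ M := (le_max_left _ _).trans (le_max_right _ _)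
    have h2 : N (A 2 ω) ≤ M := (le_max_right _ _).trans (le_max_right _ _)
    have hM0 : 0 ≤ M := (apply_nonneg N _).trans h0
    have habs : |α| + |β| + |γ| ≤ Real.sqrt 3 := by
      refine Real.le_sqrt_of_sq_le ?_
      nlinarith [sq_abs α, sq_abs β, sq_abs γ, sq_nonneg (|α| - |β|), sq_nonneg (|α| - |γ|),
        sq_nonneg (|β| - |γ|)]
    calc N (B ω) ≤ N (α • A 0 ω) + N (β • A 1 ω) + N (γ • A 2 ω) := by
          rw [hB]
          exact (map_add_le_add N _ _).trans (by gcongr; exact map_add_le_add N _ _)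
      _ = |α| * N (A 0 ω) + |β| * N (A 1 ω) + |γ| * N (A 2 ω) := by
          simp only [map_smul_eq_mul, Real.norm_eq_abs]
      _ ≤ |α| * M + |β| * M + |γ| * M := by gcongr
      _ = (|α| + |β| + |γ|) * M := by ring
      _ ≤ Real.sqrt 3 * M := by gcongr
end
end
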